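/- arXiv:2602.12219 — 2 statements merged into one kernel-verified Lean document; each statement's English description precedes it below -/
import Mathlib

section
/- Let q be a prime power, let V = F_q^n, and let t, k be integers with 0 ≤ t ≤ k. Let 𝓕 be a family of k-dimensional F_q-subspaces of V such that dim(U ∩ U') ≥ t for all U, U' ∈ 𝓕. If n ≥ 2k, then |𝓕| ≤ [n−t choose k−t]_q, and equality holds if and only if either 𝓕 is the set of all k-dimensional subspaces of V containing a fixed t-dimensional subspace, or n = 2k and 𝓕 is the set of all k-dimensional subspaces contained in a fixed (2k−t)-dimensional subspace of V. -/
/-- The Gaussian binomial coefficient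
`[n choose k]_q = ∏_{i=0}^{k-1} (q^{n-i} - 1) / (q^{k-i} - 1)`
(the quotient of the two integer products; it is an exact division). -/
def gaussBinom (q n k : ℕ) : ℕ :=
  (∏ i ∈ Finset.range k, (q ^ (n - i) - 1)) / ∏ i ∈ Finset.range k, (q ^ (k - i) - 1)

section partA
open Classical Finset

namespace EKRq

set_option linter.unusedSectionVars false

abbrev X (𝔽 V : Type*) [Field 𝔽] [AddCommGroup V] [Module 𝔽 V] (k : ℕ) : Type _ :=
  {U : Submodule 𝔽 V // Module.finrank 𝔽 U = k}

abbrev qq (𝔽 : Type*) [Fintype 𝔽] : ℝ := (Fintype.card 𝔽 : ℝ)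

noncomputable instance instFintypeSub (𝔽 V : Type*) [Field 𝔽] [AddCommGroup V] [Module 𝔽 V]
    [Fintype V] : Fintype (Submodule 𝔽 V) := Fintype.ofFinite _

section count

variable {𝔽 V : Type*} [Field 𝔽] [Fintype 𝔽] [AddCommGroup V] [Module 𝔽 V] [Fintype V]

lemma qq_ge : (2 : ℝ) ≤ qq 𝔽 := by
  have : 1 < Fintype.card 𝔽 := Fintype.one_lt_card
  unfold qq
  exact_mod_cast this

lemma sum_mem (U : Submodule 𝔽 V) :
    (∑ v : V, if v ∈ U then (1 : ℝ) else 0) = qq 𝔽 ^ Module.finrank 𝔽 U := by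
  rw [Finset.sum_boole]
  have h := Module.card_eq_pow_finrank (K := 𝔽) (V := U)
  have h2 : Fintype.card U = (Finset.univ.filter (fun v : V => v ∈ U)).card :=
    Fintype.card_subtype _
  rw [← h2, h]
  push_cast
  rfl

lemma sum_mem_diff {U W : Submodule 𝔽 V} (h : U ≤ W) :
    (∑ v : V, if v ∈ W ∧ v ∉ U then (1 : ℝ) else 0)
      = qq 𝔽 ^ Module.finrank 𝔽 W - qq 𝔽 ^ Module.finrank 𝔽 U := by
  rw [← sum_mem, ← sum_mem, ← Finset.sum_sub_distrib]
  refine Finset.sum_congr rfl fun v _ => ?_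
  by_cases h1 : v ∈ W
  · by_cases h2 : v ∈ U <;> simp [h1, h2]
  · have h2 : v ∉ U := fun h3 => h1 (h h3)
    simp [h1, h2]

lemma finrank_sup_span {J : Submodule 𝔽 V} {v : V} (h : v ∉ J) :
    Module.finrank 𝔽 ↥(J ⊔ Submodule.span 𝔽 {v}) = Module.finrank 𝔽 J + 1 := by
  have hv : v ≠ 0 := fun h0 => h (h0 ▸ J.zero_mem)
  have h1 := Submodule.finrank_sup_add_finrank_inf_eq J (Submodule.span 𝔽 {v})
  have h2 : Disjoint J (Submodule.span 𝔽 {v}) :=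
    Submodule.disjoint_span_singleton.2 fun h3 => absurd h3 h
  rw [h2.eq_bot, finrank_bot, finrank_span_singleton hv] at h1
  omega

lemma disj_sup_span {J U : Submodule 𝔽 V} {v : V} (hJ : Disjoint J U) (h : v ∉ J ⊔ U) :
    Disjoint (J ⊔ Submodule.span 𝔽 {v}) U := by
  have h2 : Disjoint (J ⊔ U) (Submodule.span 𝔽 {v}) :=
    Submodule.disjoint_span_singleton.2 fun h3 => absurd h3 h
  rw [sup_comm] at h2
  exact (hJ.symm.disjoint_sup_right_of_disjoint_sup_left h2).symm

/-- Indicator as a real number. -/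
noncomputable def ind (p : Prop) : ℝ := if p then 1 else 0

lemma ind_true {p : Prop} (h : p) : ind p = 1 := if_pos h
lemma ind_false {p : Prop} (h : ¬ p) : ind p = 0 := if_neg h
lemma ind_nonneg (p : Prop) : 0 ≤ ind p := by unfold ind; split_ifs <;> norm_num
lemma ind_mul (p r : Prop) : ind p * ind r = ind (p ∧ r) := by
  unfold ind; by_cases p <;> by_cases r <;> simp_all
lemma ind_congr {p r : Prop} (h : p ↔ r) : ind p = ind r := by rw [propext h]

lemma cnt_mul (k : ℕ) (U E : Submodule 𝔽 V) (hU : U ≤ E) (d : ℕ) :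
    ∀ (j : ℕ) (J : Submodule 𝔽 V), Module.finrank 𝔽 J = j → j + d = k → J ≤ E → Disjoint J U →
    (∑ z : X 𝔽 V k, ind (J ≤ z.1 ∧ z.1 ≤ E ∧ Disjoint z.1 U))
      * ∏ i ∈ Finset.Ico j k, (qq 𝔽 ^ k - qq 𝔽 ^ i)
      = ∏ i ∈ Finset.Ico j k,
        (qq 𝔽 ^ Module.finrank 𝔽 E - qq 𝔽 ^ (Module.finrank 𝔽 U + i)) := by
  induction d with
  | zero =>
    intro j J hJ hjk hJE hJU
    have hjk : j = k := by omega
    subst hjk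
    simp only [Finset.Ico_self, Finset.prod_empty, mul_one]
    rw [Finset.sum_eq_single ⟨J, hJ⟩]
    · exact ind_true ⟨le_rfl, hJE, hJU⟩
    · intro z _ hz
      refine ind_false fun h => hz ?_
      apply Subtype.ext
      exact (Submodule.eq_of_le_of_finrank_le h.1 (by rw [z.2, hJ])).symm
    · intro h; exact absurd (Finset.mem_univ _) h
  | succ d ih =>
    intro j J hJ hjk hJE hJU
    have hlt : j < k := by omega
    rw [Finset.prod_eq_prod_Ico_succ_bot hlt, Finset.prod_eq_prod_Ico_succ_bot hlt]
    set P := ∏ i ∈ Finset.Ico (j + 1) k, (qq 𝔽 ^ k - qq 𝔽 ^ i) with hP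
    set R := ∏ i ∈ Finset.Ico (j + 1) k,
        (qq 𝔽 ^ Module.finrank 𝔽 E - qq 𝔽 ^ (Module.finrank 𝔽 U + i)) with hR
    have key : (∑ z : X 𝔽 V k, ind (J ≤ z.1 ∧ z.1 ≤ E ∧ Disjoint z.1 U)) * (qq 𝔽 ^ k - qq 𝔽 ^ j)
        = ∑ v : V, ∑ z : X 𝔽 V k, ind ((J ≤ z.1 ∧ z.1 ≤ E ∧ Disjoint z.1 U) ∧ v ∈ z.1 ∧ v ∉ J) := by
      rw [Finset.sum_comm, Finset.sum_mul]
      refine Finset.sum_congr rfl fun z _ => ?_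
      by_cases hz : J ≤ z.1 ∧ z.1 ≤ E ∧ Disjoint z.1 U
      · have := sum_mem_diff hz.1
        rw [z.2, hJ] at this
        rw [← this, ind_true hz, one_mul]
        refine Finset.sum_congr rfl fun v _ => ?_
        unfold ind
        simp only [hz, true_and, and_self]
      · rw [ind_false hz, zero_mul]
        symm
        refine Finset.sum_eq_zero fun v _ => ind_false fun h => hz h.1
    have key2 : ∀ v : V, (∑ z : X 𝔽 V k,
        ind ((J ≤ z.1 ∧ z.1 ≤ E ∧ Disjoint z.1 U) ∧ v ∈ z.1 ∧ v ∉ J)) * P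
        = (if v ∈ E ∧ v ∉ J ⊔ U then (1 : ℝ) else 0) * R := by
      intro v
      by_cases hv : v ∈ E ∧ v ∉ J ⊔ U
      · rw [if_pos hv, one_mul]
        have hvJ : v ∉ J := fun h => hv.2 (Submodule.mem_sup_left h)
        have := ih (j + 1) (J ⊔ Submodule.span 𝔽 {v}) (by rw [finrank_sup_span hvJ, hJ]) (by omega)
          (sup_le hJE (by rw [Submodule.span_singleton_le_iff_mem]; exact hv.1))
          (disj_sup_span hJU hv.2)
        rw [← hP, ← hR] at this
        rw [← this]
        congr 1
        refine Finset.sum_congr rfl fun z _ => ind_congr ?_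
        rw [sup_le_iff, Submodule.span_singleton_le_iff_mem]
        tauto
      · rw [if_neg hv, zero_mul]
        have : ∑ z : X 𝔽 V k,
          ind ((J ≤ z.1 ∧ z.1 ≤ E ∧ Disjoint z.1 U) ∧ v ∈ z.1 ∧ v ∉ J) = 0 := by
          refine Finset.sum_eq_zero fun z _ => ind_false ?_
          rintro ⟨⟨h1, h2, h3⟩, h4, h5⟩
          apply hv
          refine ⟨h2 h4, fun h6 => ?_⟩
          obtain ⟨a, ha, b, hb, rfl⟩ := Submodule.mem_sup.1 h6
          have hbz : b ∈ z.1 := by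
            have := z.1.sub_mem h4 (h1 ha)
            simpa using this
          have hb0 : b = 0 := by
            have := Submodule.disjoint_def.1 h3 b hbz hb
            exact this
          subst hb0
          exact h5 (by simpa using ha)
        rw [this, zero_mul]
    rw [← mul_assoc, key, Finset.sum_mul, Finset.sum_congr rfl fun v _ => key2 v, ← Finset.sum_mul,
      sum_mem_diff (sup_le hJE hU)]
    have hsup := Submodule.finrank_sup_add_finrank_inf_eq J U
    rw [hJU.eq_bot, finrank_bot, hJ] at hsup
    rw [show Module.finrank 𝔽 ↥(J ⊔ U) = Module.finrank 𝔽 U + j by omega]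

/-- the closed formula -/
noncomputable def cc (q : ℝ) (e u j k : ℕ) : ℝ :=
  ∏ i ∈ Finset.Ico j k, ((q ^ e - q ^ (u + i)) / (q ^ k - q ^ i))

lemma pow_sub_pos {q : ℝ} (hq : 2 ≤ q) {i k : ℕ} (h : i < k) : 0 < q ^ k - q ^ i :=
  sub_pos.2 (pow_lt_pow_right₀ (by linarith) h)

lemma cnt (k j : ℕ) (J U E : Submodule 𝔽 V) (hU : U ≤ E) (hJ : Module.finrank 𝔽 J = j)
    (hjk : j ≤ k) (hJE : J ≤ E) (hJU : Disjoint J U) :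
    (∑ z : X 𝔽 V k, ind (J ≤ z.1 ∧ z.1 ≤ E ∧ Disjoint z.1 U))
      = cc (qq 𝔽) (Module.finrank 𝔽 E) (Module.finrank 𝔽 U) j k := by
  have h := cnt_mul k U E hU (k - j) j J hJ (by omega) hJE hJU
  unfold cc
  rw [Finset.prod_div_distrib, ← h, mul_div_cancel_right₀]
  refine Finset.prod_ne_zero_iff.2 fun i hi => ?_
  rw [Finset.mem_Ico] at hi
  exact (pow_sub_pos qq_ge hi.2).ne'

lemma cnt_le (k j : ℕ) (J E : Submodule 𝔽 V) (hJ : Module.finrank 𝔽 J = j)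
    (hjk : j ≤ k) (hJE : J ≤ E) :
    (∑ z : X 𝔽 V k, ind (J ≤ z.1 ∧ z.1 ≤ E))
      = cc (qq 𝔽) (Module.finrank 𝔽 E) 0 j k := by
  have := cnt k j J ⊥ E bot_le hJ hjk hJE disjoint_bot_right
  rw [finrank_bot] at this
  rw [← this]
  refine Finset.sum_congr rfl fun z _ => ind_congr ?_
  simp

lemma cnt_ge (k j : ℕ) (J : Submodule 𝔽 V) (hJ : Module.finrank 𝔽 J = j) (hjk : j ≤ k) :
    (∑ z : X 𝔽 V k, ind (J ≤ z.1)) = cc (qq 𝔽) (Module.finrank 𝔽 V) 0 j k := by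
  have := cnt_le k j J ⊤ hJ hjk le_top
  rw [finrank_top] at this
  rw [← this]
  refine Finset.sum_congr rfl fun z _ => ind_congr ?_
  simp

lemma cnt_disj (k j : ℕ) (J U : Submodule 𝔽 V) (hJ : Module.finrank 𝔽 J = j) (hjk : j ≤ k)
    (hJU : Disjoint J U) :
    (∑ z : X 𝔽 V k, ind (J ≤ z.1 ∧ Disjoint z.1 U))
      = cc (qq 𝔽) (Module.finrank 𝔽 V) (Module.finrank 𝔽 U) j k := by
  have := cnt k j J U ⊤ le_top hJ hjk le_top hJU
  rw [finrank_top] at this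
  rw [← this]
  refine Finset.sum_congr rfl fun z _ => ind_congr ?_
  simp

lemma cc_self (q : ℝ) (e u k : ℕ) : cc q e u k k = 1 := by simp [cc]

lemma cc_succ (q : ℝ) (e u j k : ℕ) (h : j < k) :
    cc q e u j k = (q ^ e - q ^ (u + j)) / (q ^ k - q ^ j) * cc q e u (j + 1) k := by
  unfold cc
  rw [Finset.prod_eq_prod_Ico_succ_bot h]

lemma cc_pos {q : ℝ} (hq : 2 ≤ q) {e u j k : ℕ} (h : u + k ≤ e) : 0 < cc q e u j k := by
  refine Finset.prod_pos fun i hi => ?_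
  rw [Finset.mem_Ico] at hi
  exact div_pos (pow_sub_pos hq (by omega)) (pow_sub_pos hq (by omega))

/-- number of hyperplanes -/
lemma cc_hyper {q : ℝ} (hq : 2 ≤ q) (κ d : ℕ) : ∀ j, j + d = κ →
    cc q (κ + 1) 0 j κ = (q ^ (κ + 1 - j) - 1) / (q - 1) := by
  have hq1 : q - 1 ≠ 0 := by linarith
  induction d with
  | zero =>
    intro j h
    have : j = κ := by omega
    subst this
    rw [cc_self, show j + 1 - j = 1 by omega, pow_one, div_self hq1]
  | succ d ih =>
    intro j h
    rw [cc_succ _ _ _ _ _ (by omega), ih (j + 1) (by omega)]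
    have h1 := (pow_sub_pos hq (show j < κ by omega)).ne'
    have e1 : κ + 1 - (j + 1) = d + 1 := by omega
    have e2 : κ + 1 - j = d + 2 := by omega
    rw [e1, e2]
    have e3 : κ = j + (d + 1) := by omega
    rw [e3] at h1 ⊢
    rw [div_mul_div_comm, div_eq_div_iff (mul_ne_zero h1 hq1) hq1]
    ring

lemma cc_top {q : ℝ} (hq : 2 ≤ q) (n k : ℕ) (h : k + 1 ≤ n) :
    cc q n 0 k (k + 1) = (q ^ (n - k) - 1) / (q - 1) := by
  have hq1 : q - 1 ≠ 0 := by linarith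
  rw [cc_succ _ _ _ _ _ (by omega), cc_self, mul_one]
  obtain ⟨m, rfl⟩ : ∃ m, n = k + m := ⟨n - k, by omega⟩
  rw [Nat.add_sub_cancel_left, div_eq_div_iff (pow_sub_pos hq (by omega)).ne' hq1]
  ring

/-- Moebius weights -/
noncomputable def mu (q : ℝ) (l : ℕ) : ℝ := ∏ i ∈ Finset.range l, (-q ^ i)

lemma mu_cc {q : ℝ} (hq : 2 ≤ q) (a l : ℕ) :
    mu q l * cc q a 0 0 l = ∏ i ∈ Finset.range l, ((q ^ i - q ^ a) / (q ^ (i + 1) - 1)) := by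
  unfold mu cc
  rw [Finset.prod_div_distrib, Finset.prod_div_distrib, ← Finset.range_eq_Ico]
  have h1 : ∏ i ∈ Finset.range l, (q ^ l - q ^ i)
      = (∏ i ∈ Finset.range l, q ^ i) * ∏ i ∈ Finset.range l, (q ^ (i + 1) - 1) := by
    rw [← Finset.prod_range_reflect (fun i => q ^ (i + 1) - 1), ← Finset.prod_mul_distrib]
    refine Finset.prod_congr rfl fun i hi => ?_
    rw [Finset.mem_range] at hi
    rw [mul_sub, ← pow_add, show i + (l - 1 - i + 1) = l by omega, mul_one]
  have h2 : ∏ i ∈ Finset.range l, q ^ i ≠ 0 :=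
    Finset.prod_ne_zero_iff.2 fun i _ => pow_ne_zero _ (by linarith)
  have h3 : ∏ i ∈ Finset.range l, (q ^ (i + 1) - 1) ≠ 0 :=
    Finset.prod_ne_zero_iff.2 fun i _ => by
      have := pow_sub_pos hq (Nat.succ_pos i)
      simp only [pow_zero, Nat.succ_eq_add_one] at this
      exact this.ne'
  have h4 : (∏ i ∈ Finset.range l, (-q ^ i)) * ∏ i ∈ Finset.range l, (q ^ a - q ^ (0 + i))
      = (∏ i ∈ Finset.range l, q ^ i) * ∏ i ∈ Finset.range l, (q ^ i - q ^ a) := by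
    rw [← Finset.prod_mul_distrib, ← Finset.prod_mul_distrib]
    refine Finset.prod_congr rfl fun i _ => ?_
    rw [zero_add]
    ring
  rw [h1, ← mul_div_assoc, h4, mul_div_mul_left _ _ h2]

lemma mu_sum {q : ℝ} (hq : 2 ≤ q) (a j : ℕ) :
    ∑ l ∈ Finset.range (j + 1), mu q l * cc q a 0 0 l
      = ∏ i ∈ Finset.range j, ((q ^ (i + 1) - q ^ a) / (q ^ (i + 1) - 1)) := by
  have h0 : ∀ j : ℕ, q ^ (j + 1) - 1 ≠ 0 := fun j => by
    have := pow_sub_pos hq (Nat.succ_pos j)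
    simp only [pow_zero, Nat.succ_eq_add_one] at this
    exact this.ne'
  induction j with
  | zero => simp [mu, cc]
  | succ j ih =>
    rw [Finset.sum_range_succ, ih, mu_cc hq]
    have h1 : ∏ i ∈ Finset.range (j + 1), ((q ^ i - q ^ a) / (q ^ (i + 1) - 1))
        = (1 - q ^ a) / (q ^ (j + 1) - 1)
          * ∏ i ∈ Finset.range j, ((q ^ (i + 1) - q ^ a) / (q ^ (i + 1) - 1)) := by
      rw [Finset.prod_div_distrib, Finset.prod_range_succ', Finset.prod_range_succ (n := j),
        Finset.prod_div_distrib, pow_zero]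
      have h3 : ∏ i ∈ Finset.range j, (q ^ (i + 1) - 1) ≠ 0 :=
        Finset.prod_ne_zero_iff.2 fun i _ => h0 i
      have := h0 j
      field_simp
    rw [h1, Finset.prod_range_succ (n := j)]
    generalize ∏ i ∈ Finset.range j, ((q ^ (i + 1) - q ^ a) / (q ^ (i + 1) - 1)) = P
    have := h0 j
    field_simp
    ring

lemma cnt_zero (l : ℕ) (A : Submodule 𝔽 V) :
    (∑ L : X 𝔽 V l, ind (L.1 ≤ A)) = cc (qq 𝔽) (Module.finrank 𝔽 A) 0 0 l := by
  have := cnt_le l 0 ⊥ A (finrank_bot 𝔽 V) (Nat.zero_le _) bot_le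
  rw [← this]
  refine Finset.sum_congr rfl fun z _ => ind_congr ?_
  simp

/-- Moebius inversion -/
lemma moebius (j : ℕ) (A : Submodule 𝔽 V) (hA : Module.finrank 𝔽 A ≤ j) :
    ∑ l ∈ Finset.range (j + 1), mu (qq 𝔽) l * (∑ L : X 𝔽 V l, ind (L.1 ≤ A)) = ind (A = ⊥) := by
  simp_rw [cnt_zero]
  rw [mu_sum qq_ge]
  by_cases h : A = ⊥
  · rw [ind_true h]
    subst h
    rw [finrank_bot]
    refine Finset.prod_eq_one fun i _ => ?_
    rw [pow_zero]
    refine div_self ?_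
    have := pow_sub_pos (qq_ge (𝔽 := 𝔽)) (Nat.succ_pos i)
    simp only [pow_zero, Nat.succ_eq_add_one] at this
    exact this.ne'
  · rw [ind_false h]
    have h1 : Module.finrank 𝔽 A ≠ 0 := fun h2 => h (Submodule.finrank_eq_zero.1 h2)
    refine Finset.prod_eq_zero (i := Module.finrank 𝔽 A - 1) (Finset.mem_range.2 (by omega)) ?_
    rw [show Module.finrank 𝔽 A - 1 + 1 = Module.finrank 𝔽 A by omega, sub_self, zero_div]

end count

end EKRq

end partA

section partB
open Classical Finset

namespace EKRq

set_option linter.unusedSectionVars false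

section ops

variable {𝔽 V : Type*} [Field 𝔽] [Fintype 𝔽] [AddCommGroup V] [Module 𝔽 V] [Fintype V]

noncomputable def lift (j k : ℕ) : (X 𝔽 V j → ℝ) →ₗ[ℝ] (X 𝔽 V k → ℝ) where
  toFun h := fun U => ∑ J : X 𝔽 V j, ind (J.1 ≤ U.1) * h J
  map_add' f g := by
    funext U; simp only [Pi.add_apply, mul_add, Finset.sum_add_distrib]
  map_smul' c f := by
    funext U; simp only [Pi.smul_apply, smul_eq_mul, RingHom.id_apply, Finset.mul_sum]
    exact Finset.sum_congr rfl fun _ _ => by ring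

noncomputable def down (k i : ℕ) : (X 𝔽 V k → ℝ) →ₗ[ℝ] (X 𝔽 V i → ℝ) where
  toFun f := fun L => ∑ z : X 𝔽 V k, ind (L.1 ≤ z.1) * f z
  map_add' f g := by
    funext U; simp only [Pi.add_apply, mul_add, Finset.sum_add_distrib]
  map_smul' c f := by
    funext U; simp only [Pi.smul_apply, smul_eq_mul, RingHom.id_apply, Finset.mul_sum]
    exact Finset.sum_congr rfl fun _ _ => by ring

lemma lift_apply (j k : ℕ) (h : X 𝔽 V j → ℝ) (U : X 𝔽 V k) :
    lift j k h U = ∑ J : X 𝔽 V j, ind (J.1 ≤ U.1) * h J := rfl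
lemma down_apply (k i : ℕ) (f : X 𝔽 V k → ℝ) (L : X 𝔽 V i) :
    down k i f L = ∑ z : X 𝔽 V k, ind (L.1 ≤ z.1) * f z := rfl

variable (𝔽 V) in
noncomputable def N (k : ℕ) : Module.End ℝ (X 𝔽 V k → ℝ) := lift (k - 1) k ∘ₗ down k (k - 1)

variable (𝔽 V) in
noncomputable def K (k : ℕ) : Module.End ℝ (X 𝔽 V k → ℝ) where
  toFun f := fun U => ∑ z : X 𝔽 V k, ind (Disjoint z.1 U.1) * f z
  map_add' f g := by
    funext U; simp only [Pi.add_apply, mul_add, Finset.sum_add_distrib]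
  map_smul' c f := by
    funext U; simp only [Pi.smul_apply, smul_eq_mul, RingHom.id_apply, Finset.mul_sum]
    exact Finset.sum_congr rfl fun _ _ => by ring

lemma K_apply (k : ℕ) (f : X 𝔽 V k → ℝ) (U : X 𝔽 V k) :
    K 𝔽 V k f U = ∑ z : X 𝔽 V k, ind (Disjoint z.1 U.1) * f z := rfl

variable (𝔽 V) in
noncomputable def G (k : ℕ) : Module.End ℝ (X 𝔽 V k → ℝ) where
  toFun f := fun U => ∑ v : V, ind (v ∈ U.1) * ∑ z : X 𝔽 V k, ind (v ∈ z.1) * f z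
  map_add' f g := by
    funext U; simp only [Pi.add_apply, mul_add, Finset.sum_add_distrib]
  map_smul' c f := by
    funext U; simp only [Pi.smul_apply, smul_eq_mul, RingHom.id_apply, Finset.mul_sum]
    exact Finset.sum_congr rfl fun _ _ => Finset.sum_congr rfl fun _ _ => by ring

lemma G_apply (k : ℕ) (f : X 𝔽 V k → ℝ) (U : X 𝔽 V k) :
    G 𝔽 V k f U = ∑ v : V, ind (v ∈ U.1) * ∑ z : X 𝔽 V k, ind (v ∈ z.1) * f z := rfl

variable (𝔽 V) in
def Harm (j : ℕ) : Submodule ℝ (X 𝔽 V j → ℝ) where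
  carrier := {h | ∀ L : Submodule 𝔽 V, Module.finrank 𝔽 L < j →
    ∑ J : X 𝔽 V j, ind (L ≤ J.1) * h J = 0}
  add_mem' {f g} hf hg L hL := by
    simp only [Pi.add_apply, mul_add, Finset.sum_add_distrib, hf L hL, hg L hL, add_zero]
  zero_mem' L hL := by simp
  smul_mem' c f hf L hL := by
    have := hf L hL
    simp only [Pi.smul_apply, smul_eq_mul]
    rw [← mul_zero c, ← this, Finset.mul_sum]
    exact Finset.sum_congr rfl fun _ _ => by ring

variable (𝔽 V) in
noncomputable def H (j k : ℕ) : Submodule ℝ (X 𝔽 V k → ℝ) := (Harm 𝔽 V j).map (lift j k)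

noncomputable def star (k : ℕ) (T : Submodule 𝔽 V) : X 𝔽 V k → ℝ := fun U => ind (T ≤ U.1)

variable (𝔽 V) in
noncomputable def M (k t : ℕ) : Submodule ℝ (X 𝔽 V k → ℝ) :=
  Submodule.span ℝ {f | ∃ T : Submodule 𝔽 V, Module.finrank 𝔽 T ≤ t ∧ f = star k T}

lemma cc_full {q : ℝ} (hq : 2 ≤ q) (l : ℕ) : cc q l 0 0 l = 1 := by
  unfold cc
  refine Finset.prod_eq_one fun i hi => ?_
  rw [Finset.mem_Ico] at hi
  rw [zero_add]
  exact div_self (pow_sub_pos hq hi.2).ne'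

lemma not_le_of_finrank {A B : Submodule 𝔽 V}
    (h : Module.finrank 𝔽 B < Module.finrank 𝔽 A) : ¬ A ≤ B := fun h1 =>
  absurd (Submodule.finrank_mono h1) (by omega)

lemma finrank_inf_lt {j : ℕ} (J : X 𝔽 V j) {U : Submodule 𝔽 V} (h : ¬ J.1 ≤ U) :
    Module.finrank 𝔽 ↥(J.1 ⊓ U) < j :=
  lt_of_lt_of_eq (Submodule.finrank_lt_finrank_of_lt
    (lt_of_le_of_ne inf_le_left fun h1 => h (inf_eq_left.1 h1))) J.2

lemma cnt_between (i j k : ℕ) (J : X 𝔽 V j) (U : X 𝔽 V k) (hji : j ≤ i) :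
    (∑ z : X 𝔽 V i, ind (J.1 ≤ z.1 ∧ z.1 ≤ U.1)) = cc (qq 𝔽) k 0 j i * ind (J.1 ≤ U.1) := by
  by_cases h : J.1 ≤ U.1
  · rw [ind_true h, mul_one, cnt_le i j J.1 U.1 J.2 hji h, U.2]
  · rw [ind_false h, mul_zero]
    exact Finset.sum_eq_zero fun z _ => ind_false fun h1 => h (h1.1.trans h1.2)

lemma lift_lift (i j k : ℕ) (hji : j ≤ i) (h : X 𝔽 V j → ℝ) :
    lift i k (lift j i h) = cc (qq 𝔽) k 0 j i • lift j k h := by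
  funext U
  simp only [lift_apply, Pi.smul_apply, smul_eq_mul, Finset.mul_sum]
  rw [Finset.sum_comm]
  refine Finset.sum_congr rfl fun J _ => ?_
  rw [← mul_assoc, ← cnt_between i j k J U hji, Finset.sum_mul]
  refine Finset.sum_congr rfl fun z _ => ?_
  rw [← mul_assoc, ind_mul, and_comm]

lemma down_lift (κ j : ℕ) (h : X 𝔽 V j → ℝ) (hh : h ∈ Harm 𝔽 V j)
    (hn : κ + 1 ≤ Module.finrank 𝔽 V) :
    down (κ + 1) κ (lift j (κ + 1) h) =
      ((qq 𝔽 ^ (Module.finrank 𝔽 V - κ) - qq 𝔽 ^ j) / (qq 𝔽 - 1)) • lift j κ h := by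
  have hq := qq_ge (𝔽 := 𝔽)
  have hq1 : qq 𝔽 - 1 ≠ 0 := by linarith
  funext W
  have e1 : down (κ + 1) κ (lift j (κ + 1) h) W
      = ∑ J : X 𝔽 V j, (∑ z : X 𝔽 V (κ + 1), ind (J.1 ⊔ W.1 ≤ z.1)) * h J := by
    simp only [lift_apply, down_apply, Finset.mul_sum]
    rw [Finset.sum_comm]
    refine Finset.sum_congr rfl fun J _ => ?_
    rw [Finset.sum_mul]
    refine Finset.sum_congr rfl fun z _ => ?_
    rw [← mul_assoc, ind_mul, and_comm, ← ind_congr sup_le_iff]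
  have hA : ∀ J : X 𝔽 V j, J.1 ≤ W.1 → (∑ z : X 𝔽 V (κ + 1), ind (J.1 ⊔ W.1 ≤ z.1))
      = (qq 𝔽 ^ (Module.finrank 𝔽 V - κ) - 1) / (qq 𝔽 - 1) := by
    intro J hJ
    rw [sup_eq_right.2 hJ, cnt_ge (κ + 1) κ W.1 W.2 (by omega), cc_top hq _ _ hn]
  rw [e1, Pi.smul_apply, smul_eq_mul, lift_apply, Finset.mul_sum]
  rcases Nat.eq_zero_or_pos j with rfl | hj
  · refine Finset.sum_congr rfl fun J _ => ?_
    have hJ : J.1 ≤ W.1 := by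
      rw [Submodule.finrank_eq_zero.1 J.2]; exact bot_le
    rw [hA J hJ, ind_true hJ, one_mul, pow_zero]
  · obtain ⟨i, rfl⟩ : ∃ i, j = i + 1 := ⟨j - 1, by omega⟩
    have hB : ∑ J : X 𝔽 V (i + 1), (∑ L : X 𝔽 V i, ind (L.1 ≤ J.1 ⊓ W.1)) * h J = 0 := by
      simp only [Finset.sum_mul]
      rw [Finset.sum_comm]
      refine Finset.sum_eq_zero fun L _ => ?_
      have := hh L.1 (by rw [L.2]; omega)
      rw [← mul_zero (ind (L.1 ≤ W.1)), ← this, Finset.mul_sum]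
      refine Finset.sum_congr rfl fun J _ => ?_
      rw [← mul_assoc, ind_mul, and_comm, ind_congr le_inf_iff]
    rw [← sub_zero (∑ J : X 𝔽 V (i + 1), _), ← hB, ← Finset.sum_sub_distrib]
    refine Finset.sum_congr rfl fun J _ => ?_
    rw [← sub_mul, ← mul_assoc]
    congr 1
    by_cases hJ : J.1 ≤ W.1
    · rw [hA J hJ, ind_true hJ, inf_eq_left.2 hJ, cnt_zero, J.2, cc_hyper hq i i 0 (by omega)]
      simp only [Nat.sub_zero]
      field_simp
      ring
    · rw [ind_false hJ, mul_zero, sub_eq_zero]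
      have hdim := Submodule.finrank_sup_add_finrank_inf_eq J.1 W.1
      rw [J.2, W.2] at hdim
      have hlt : Module.finrank 𝔽 ↥(J.1 ⊓ W.1) < i + 1 := finrank_inf_lt J hJ
      rcases Nat.lt_or_ge (Module.finrank 𝔽 ↥(J.1 ⊓ W.1)) i with h1 | h1
      · rw [Finset.sum_eq_zero, Finset.sum_eq_zero]
        · intro L _
          exact ind_false (not_le_of_finrank (by rw [L.2]; exact h1))
        · intro z _
          exact ind_false (not_le_of_finrank (by rw [z.2]; omega))
      · rw [cnt_ge (κ + 1) (κ + 1) _ (by omega) le_rfl, cc_self, cnt_zero,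
          show Module.finrank 𝔽 ↥(J.1 ⊓ W.1) = i by omega, cc_full hq]

noncomputable def theta (q : ℝ) (n k j : ℕ) : ℝ :=
  (q ^ (n - k + 1) - q ^ j) * (q ^ (k - j) - 1) / (q - 1) ^ 2

lemma N_lift (k j : ℕ) (hk : 1 ≤ k) (hkn : k ≤ Module.finrank 𝔽 V) (hj : j ≤ k)
    (φ : X 𝔽 V k → ℝ) (hφ : φ ∈ H 𝔽 V j k) :
    N 𝔽 V k φ = theta (qq 𝔽) (Module.finrank 𝔽 V) k j • φ := by
  obtain ⟨h, hh, rfl⟩ := hφ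
  obtain ⟨κ, rfl⟩ : ∃ κ, k = κ + 1 := ⟨k - 1, by omega⟩
  have hq := qq_ge (𝔽 := 𝔽)
  change lift κ (κ + 1) (down (κ + 1) κ (lift j (κ + 1) h)) = _
  rw [down_lift κ j h hh hkn, map_smul]
  rcases Nat.lt_or_ge κ j with h1 | h1
  · have : j = κ + 1 := by omega
    subst this
    have h0 : lift (κ + 1) κ h = 0 := by
      funext W
      rw [lift_apply]
      refine Finset.sum_eq_zero fun J _ => ?_
      rw [ind_false (not_le_of_finrank (by rw [J.2, W.2]; omega)), zero_mul]
    rw [h0, map_zero, smul_zero]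
    simp [theta]
  · rw [lift_lift κ j (κ + 1) h1, smul_smul, cc_hyper hq κ (κ - j) j (by omega)]
    congr 1
    unfold theta
    rw [div_mul_div_comm, ← pow_two, show Module.finrank 𝔽 V - (κ + 1) + 1 = Module.finrank 𝔽 V - κ by omega]

noncomputable def beta (q : ℝ) (n k j : ℕ) : ℝ := mu q j * cc q n k j k

lemma sum_disj (j : ℕ) (h : X 𝔽 V j → ℝ) (hh : h ∈ Harm 𝔽 V j) (U : Submodule 𝔽 V) :
    ∑ J : X 𝔽 V j, ind (Disjoint J.1 U) * h J
      = mu (qq 𝔽) j * ∑ J : X 𝔽 V j, ind (J.1 ≤ U) * h J := by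
  have h1 : ∀ J : X 𝔽 V j, ind (Disjoint J.1 U)
      = ∑ l ∈ Finset.range (j + 1), mu (qq 𝔽) l * (∑ L : X 𝔽 V l, ind (L.1 ≤ J.1 ⊓ U)) := by
    intro J
    rw [moebius j _ ((Submodule.finrank_mono inf_le_left).trans J.2.le), ind_congr disjoint_iff]
  simp only [h1, Finset.sum_mul]
  rw [Finset.sum_comm, Finset.sum_range_succ, Finset.sum_eq_zero, zero_add, Finset.mul_sum]
  · refine Finset.sum_congr rfl fun J _ => ?_
    rw [cnt_zero, mul_assoc]
    congr 2
    by_cases hJ : J.1 ≤ U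
    · rw [ind_true hJ, inf_eq_left.2 hJ, J.2, cc_full qq_ge]
    · rw [ind_false hJ, ← cnt_zero]
      refine Finset.sum_eq_zero fun L _ => ind_false (not_le_of_finrank ?_)
      rw [L.2]
      exact finrank_inf_lt J hJ
  · intro l hl
    rw [Finset.mem_range] at hl
    have : ∑ J : X 𝔽 V j, (∑ L : X 𝔽 V l, ind (L.1 ≤ J.1 ⊓ U)) * h J = 0 := by
      simp only [Finset.sum_mul]
      rw [Finset.sum_comm]
      refine Finset.sum_eq_zero fun L _ => ?_
      have := hh L.1 (by rw [L.2]; omega)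
      rw [← mul_zero (ind (L.1 ≤ U)), ← this, Finset.mul_sum]
      refine Finset.sum_congr rfl fun J _ => ?_
      rw [← mul_assoc, ind_mul, and_comm, ind_congr le_inf_iff]
    rw [← mul_zero (mu (qq 𝔽) l), ← this, Finset.mul_sum]
    exact Finset.sum_congr rfl fun J _ => by ring

lemma K_lift (k j : ℕ) (hj : j ≤ k) (φ : X 𝔽 V k → ℝ) (hφ : φ ∈ H 𝔽 V j k) :
    K 𝔽 V k φ = beta (qq 𝔽) (Module.finrank 𝔽 V) k j • φ := by
  obtain ⟨h, hh, rfl⟩ := hφ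
  funext U
  rw [Pi.smul_apply, smul_eq_mul, lift_apply, beta, mul_right_comm, ← sum_disj j h hh, K_apply]
  simp only [lift_apply, Finset.mul_sum]
  rw [Finset.sum_comm, Finset.sum_mul]
  refine Finset.sum_congr rfl fun J _ => ?_
  rw [mul_right_comm]
  by_cases hJ : Disjoint J.1 U.1
  · rw [ind_true hJ, one_mul]
    have := cnt_disj k j J.1 U.1 J.2 hj hJ
    rw [U.2] at this
    rw [← this, Finset.sum_mul]
    refine Finset.sum_congr rfl fun z _ => ?_
    rw [← mul_assoc, ind_mul, and_comm]
  · rw [ind_false hJ, zero_mul, zero_mul]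
    refine Finset.sum_eq_zero fun z _ => ?_
    rw [← mul_assoc, ind_mul, ind_false, zero_mul]
    rintro ⟨h1, h2⟩
    exact hJ (h1.mono_left h2)

/-- sums over stars vanish on higher components -/
lemma sum_star_lift (k j : ℕ) (φ : X 𝔽 V k → ℝ) (hφ : φ ∈ H 𝔽 V j k) (hj : 1 ≤ j) (hjk : j ≤ k) :
    ∑ z, φ z = 0 := by
  obtain ⟨h, hh, rfl⟩ := hφ
  simp only [lift_apply]
  rw [Finset.sum_comm]
  have h1 : ∀ J : X 𝔽 V j, ∑ z : X 𝔽 V k, ind (J.1 ≤ z.1) * h J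
      = cc (qq 𝔽) (Module.finrank 𝔽 V) 0 j k * (ind ((⊥ : Submodule 𝔽 V) ≤ J.1) * h J) := by
    intro J
    rw [← Finset.sum_mul, cnt_ge k j J.1 J.2 hjk, ind_true bot_le, one_mul]
  rw [Finset.sum_congr rfl fun J _ => h1 J, ← Finset.mul_sum, hh ⊥ (by rw [finrank_bot]; omega), mul_zero]

lemma G_lift (k j : ℕ) (hj1 : 1 ≤ j) (hjk : j ≤ k) : ∃ γ : ℝ, ∀ φ ∈ H 𝔽 V j k,
    G 𝔽 V k φ = γ • φ := by
  obtain ⟨a, ha⟩ : ∃ a : ℝ, a = cc (qq 𝔽) (Module.finrank 𝔽 V) 0 j k := ⟨_, rfl⟩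
  obtain ⟨b, hb⟩ : ∃ b : ℝ, ∀ J : X 𝔽 V j, ∀ v : V, v ∉ J.1 →
      ∑ z : X 𝔽 V k, ind (J.1 ⊔ Submodule.span 𝔽 {v} ≤ z.1) = b := by
    rcases Nat.lt_or_ge j k with h | h
    · refine ⟨cc (qq 𝔽) (Module.finrank 𝔽 V) 0 (j + 1) k, fun J v hv => ?_⟩
      exact cnt_ge k (j + 1) _ (by rw [finrank_sup_span hv, J.2]) h
    · refine ⟨0, fun J v hv => Finset.sum_eq_zero fun z _ => ind_false (not_le_of_finrank ?_)⟩
      rw [finrank_sup_span hv, J.2, z.2]; omega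
  have key : ∀ h ∈ Harm 𝔽 V j, ∀ v : V,
      ∑ z : X 𝔽 V k, ind (v ∈ z.1) * lift j k h z = (a - b) * ∑ J : X 𝔽 V j, ind (v ∈ J.1) * h J := by
    intro h hh v
    have h0 : ∑ J : X 𝔽 V j, h J = 0 := by
      rw [← hh ⊥ (by rw [finrank_bot]; omega)]
      refine Finset.sum_congr rfl fun J _ => ?_
      rw [ind_true bot_le, one_mul]
    have h1 : ∑ z : X 𝔽 V k, ind (v ∈ z.1) * lift j k h z
        = ∑ J : X 𝔽 V j, (∑ z : X 𝔽 V k, ind (J.1 ⊔ Submodule.span 𝔽 {v} ≤ z.1)) * h J := by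
      simp only [lift_apply, Finset.mul_sum]
      rw [Finset.sum_comm]
      refine Finset.sum_congr rfl fun J _ => ?_
      rw [Finset.sum_mul]
      refine Finset.sum_congr rfl fun z _ => ?_
      rw [← mul_assoc, ind_mul, and_comm, ind_congr sup_le_iff, Submodule.span_singleton_le_iff_mem]
    have h2 : ∑ J : X 𝔽 V j, (∑ z : X 𝔽 V k, ind (J.1 ⊔ Submodule.span 𝔽 {v} ≤ z.1)) * h J
        = ∑ J : X 𝔽 V j, (b * h J + (a - b) * (ind (v ∈ J.1) * h J)) := by
      refine Finset.sum_congr rfl fun J _ => ?_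
      by_cases hv : v ∈ J.1
      · rw [sup_eq_left.2 (by rwa [Submodule.span_singleton_le_iff_mem]),
          cnt_ge k j J.1 J.2 hjk, ← ha, ind_true hv]
        ring
      · rw [hb J v hv, ind_false hv]; ring
    rw [h1, h2, Finset.sum_add_distrib, ← Finset.mul_sum, ← Finset.mul_sum, h0, mul_zero, zero_add]
  rcases Nat.lt_or_ge 1 j with h2 | h2
  · refine ⟨0, ?_⟩
    rintro φ ⟨h, hh, rfl⟩
    funext U
    rw [G_apply, zero_smul, Pi.zero_apply]
    refine Finset.sum_eq_zero fun v _ => ?_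
    rw [key h hh]
    have := hh (Submodule.span 𝔽 {v}) (lt_of_le_of_lt (finrank_span_le_card ({v} : Set V)) (by simpa using h2))
    simp only [Submodule.span_singleton_le_iff_mem] at this
    rw [this, mul_zero, mul_zero]
  · have : j = 1 := by omega
    subst this
    refine ⟨(a - b) * (qq 𝔽 - 1), ?_⟩
    rintro φ ⟨h, hh, rfl⟩
    funext U
    have h0 : ∑ J : X 𝔽 V 1, h J = 0 := by
      rw [← hh ⊥ (by rw [finrank_bot]; omega)]
      refine Finset.sum_congr rfl fun J _ => ?_
      rw [ind_true bot_le, one_mul]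
    rw [G_apply, Pi.smul_apply, smul_eq_mul, lift_apply]
    have h3 : ∑ v : V, ind (v ∈ U.1) * ∑ z : X 𝔽 V k, ind (v ∈ z.1) * lift 1 k h z
        = (a - b) * ∑ J : X 𝔽 V 1, (∑ v : V, ind (v ∈ J.1 ⊓ U.1)) * h J := by
      simp only [key h hh, Finset.sum_mul]
      rw [Finset.sum_comm, Finset.mul_sum]
      refine Finset.sum_congr rfl fun v _ => ?_
      rw [Finset.mul_sum, Finset.mul_sum, Finset.mul_sum]
      refine Finset.sum_congr rfl fun J _ => ?_
      rw [ind_congr Submodule.mem_inf, ← ind_mul]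
      ring
    rw [h3, mul_assoc]
    congr 1
    have h4 : ∀ J : X 𝔽 V 1, (∑ v : V, ind (v ∈ J.1 ⊓ U.1)) * h J
        = h J + (qq 𝔽 - 1) * (ind (J.1 ≤ U.1) * h J) := by
      intro J
      have h5 : (∑ v : V, ind (v ∈ J.1 ⊓ U.1)) = qq 𝔽 ^ Module.finrank 𝔽 ↥(J.1 ⊓ U.1) := sum_mem _
      rw [h5]
      by_cases hJ : J.1 ≤ U.1
      · rw [inf_eq_left.2 hJ, J.2, ind_true hJ]; ring
      · have : Module.finrank 𝔽 ↥(J.1 ⊓ U.1) < 1 := finrank_inf_lt J hJ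
        rw [show Module.finrank 𝔽 ↥(J.1 ⊓ U.1) = 0 by omega, ind_false hJ]; ring
    rw [Finset.sum_congr rfl fun J _ => h4 J, Finset.sum_add_distrib, h0, zero_add, ← Finset.mul_sum]

end ops

end EKRq

end partB

section partC
open Classical Finset

namespace EKRq

set_option linter.unusedSectionVars false

section dec

variable {𝔽 V : Type*} [Field 𝔽] [Fintype 𝔽] [AddCommGroup V] [Module 𝔽 V] [Fintype V]

lemma orth_dec {ι : Type*} [Fintype ι] (W : Submodule ℝ (ι → ℝ)) (f : ι → ℝ) :
    ∃ a ∈ W, ∀ g ∈ W, ∑ i, g i * (f i - a i) = 0 := by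
  obtain ⟨y, hy, z, hz, h⟩ := Submodule.exists_add_mem_mem_orthogonal
    (K := W.map (WithLp.linearEquiv 2 ℝ (ι → ℝ)).symm.toLinearMap) (WithLp.toLp 2 f)
  obtain ⟨a, ha, rfl⟩ := hy
  refine ⟨a, ha, fun g hg => ?_⟩
  have h1 := hz (WithLp.toLp 2 g) ⟨g, hg, rfl⟩
  have h2 : z = WithLp.toLp 2 (f - a) := by
    rw [WithLp.toLp_sub, h]
    simp
  rw [h2] at h1
  simp only [PiLp.inner_apply] at h1
  rw [← h1]
  refine Finset.sum_congr rfl fun i _ => ?_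
  simp [mul_comm]

lemma lift_star (i k : ℕ) (L : Submodule 𝔽 V) (hL : Module.finrank 𝔽 L ≤ i) :
    lift i k (star i L) = cc (qq 𝔽) k 0 (Module.finrank 𝔽 L) i • star k L := by
  funext U
  rw [Pi.smul_apply, smul_eq_mul, lift_apply]
  have := cnt_between i _ k ⟨L, rfl⟩ U hL
  unfold star
  rw [← this]
  refine Finset.sum_congr rfl fun z _ => ?_
  rw [ind_mul, and_comm]

lemma lift_single (i k : ℕ) (T : X 𝔽 V i) :
    lift i k (fun J => ind (J = T)) = star k T.1 := by
  funext U
  rw [lift_apply, Finset.sum_eq_single T]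
  · rw [ind_true rfl, mul_one]; rfl
  · intro J _ hJ
    rw [ind_false hJ, mul_zero]
  · intro h; exact absurd (Finset.mem_univ _) h

lemma star_dec (k : ℕ) : ∀ (i : ℕ) (T : Submodule 𝔽 V), Module.finrank 𝔽 T = i → i ≤ k →
    star k T ∈ ⨆ j ∈ Finset.range (i + 1), H 𝔽 V j k := by
  intro i
  induction i using Nat.strong_induction_on with
  | _ i ih =>
    intro T hT hik
    obtain ⟨a, ha, hb⟩ := orth_dec
      (Submodule.span ℝ {f : X 𝔽 V i → ℝ | ∃ L : Submodule 𝔽 V, Module.finrank 𝔽 L < i ∧ f = star i L})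
      (fun J => ind (J = (⟨T, hT⟩ : X 𝔽 V i)))
    obtain ⟨h, hh⟩ : ∃ h, h = (fun J => ind (J = (⟨T, hT⟩ : X 𝔽 V i))) - a := ⟨_, rfl⟩
    have hharm : h ∈ Harm 𝔽 V i := by
      intro L hL
      have := hb (star i L) (Submodule.subset_span ⟨L, hL, rfl⟩)
      rw [← this, hh]; rfl
    have e : star k T = lift i k a + lift i k h := by
      rw [← map_add, hh, add_sub_cancel, lift_single]
    rw [e]
    refine Submodule.add_mem _ ?_ ?_
    · have : Submodule.span ℝ {f : X 𝔽 V i → ℝ | ∃ L : Submodule 𝔽 V, Module.finrank 𝔽 L < i ∧ f = star i L}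
        ≤ (⨆ j ∈ Finset.range (i + 1), H 𝔽 V j k).comap (lift i k) := by
        rw [Submodule.span_le]
        rintro _ ⟨L, hL, rfl⟩
        change lift i k (star i L) ∈ (⨆ j ∈ Finset.range (i + 1), H 𝔽 V j k)
        rw [lift_star i k L hL.le]
        refine Submodule.smul_mem _ _ ?_
        have h1 := ih _ hL L rfl (by omega)
        refine (?_ : (⨆ j ∈ Finset.range (Module.finrank 𝔽 L + 1), H 𝔽 V j k) ≤ _) h1
        refine iSup₂_le fun j hj => ?_
        refine le_iSup₂ (f := fun j (_ : j ∈ Finset.range (i + 1)) => H 𝔽 V j k) j ?_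
        rw [Finset.mem_range] at *; omega
      exact this ha
    · exact (le_iSup₂ (f := fun j (_ : j ∈ Finset.range (i + 1)) => H 𝔽 V j k) i (by simp)) ⟨h, hharm, rfl⟩

lemma M_le (k s : ℕ) (hs : s ≤ k) : M 𝔽 V k s ≤ ⨆ j ∈ Finset.range (s + 1), H 𝔽 V j k := by
  unfold M
  rw [Submodule.span_le]
  rintro _ ⟨L, hL, rfl⟩
  have h1 := star_dec k _ L rfl (hL.trans hs)
  refine (?_ : (⨆ j ∈ Finset.range (Module.finrank 𝔽 L + 1), H 𝔽 V j k) ≤ _) h1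
  refine iSup₂_le fun j hj => ?_
  refine le_iSup₂ (f := fun j (_ : j ∈ Finset.range (s + 1)) => H 𝔽 V j k) j ?_
  rw [Finset.mem_range] at *; omega

lemma M_dec (k s : ℕ) (hs : s ≤ k) (f : X 𝔽 V k → ℝ) (hf : f ∈ M 𝔽 V k s) :
    ∃ c : ℕ → X 𝔽 V k → ℝ, (∀ j, c j ∈ H 𝔽 V j k) ∧ f = ∑ j ∈ Finset.range (s + 1), c j := by
  obtain ⟨c, hc⟩ := (Submodule.mem_iSup_finset_iff_exists_sum _ _).1 (M_le k s hs hf)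
  exact ⟨fun j => (c j).1, fun j => (c j).2, hc.symm⟩

lemma M_mono (k : ℕ) {s t : ℕ} (h : s ≤ t) : M 𝔽 V k s ≤ M 𝔽 V k t := by
  refine Submodule.span_mono ?_
  rintro _ ⟨L, hL, rfl⟩
  exact ⟨L, hL.trans h, rfl⟩

lemma sum_single_smul (k i : ℕ) (h : X 𝔽 V i → ℝ) :
    lift i k h = ∑ J : X 𝔽 V i, h J • star k J.1 := by
  funext U
  rw [lift_apply, Finset.sum_apply]
  refine Finset.sum_congr rfl fun J _ => ?_
  rw [Pi.smul_apply, smul_eq_mul, mul_comm]; rfl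

lemma H_le_M (k j : ℕ) : H 𝔽 V j k ≤ M 𝔽 V k j := by
  rintro _ ⟨h, _, rfl⟩
  rw [sum_single_smul k]
  exact Submodule.sum_mem _ fun J _ => Submodule.smul_mem _ _ (Submodule.subset_span ⟨J.1, J.2.le, rfl⟩)

lemma mem_M_top (k : ℕ) (f : X 𝔽 V k → ℝ) : f ∈ M 𝔽 V k k := by
  have : f = lift k k f := by
    funext U
    rw [lift_apply, Finset.sum_eq_single U, ind_true le_rfl, one_mul]
    · intro J _ hJ
      rw [ind_false, zero_mul]
      intro h
      exact hJ (Subtype.ext (Submodule.eq_of_le_of_finrank_eq h (by rw [J.2, U.2])))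
    · intro h; exact absurd (Finset.mem_univ _) h
  rw [this, sum_single_smul k]
  exact Submodule.sum_mem _ fun J _ => Submodule.smul_mem _ _ (Submodule.subset_span ⟨J.1, J.2.le, rfl⟩)

lemma H_zero (k : ℕ) (φ : X 𝔽 V k → ℝ) (hφ : φ ∈ H 𝔽 V 0 k) : ∃ a : ℝ, ∀ U, φ U = a := by
  obtain ⟨h, _, rfl⟩ := hφ
  refine ⟨∑ J, h J, fun U => ?_⟩
  rw [lift_apply]
  refine Finset.sum_congr rfl fun J _ => ?_
  rw [ind_true, one_mul]
  rw [Submodule.finrank_eq_zero.1 J.2]; exact bot_le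

lemma sum_dec (k s : ℕ) (hs : s ≤ k) (c : ℕ → X 𝔽 V k → ℝ) (hc : ∀ j, c j ∈ H 𝔽 V j k) :
    ∑ z, (∑ j ∈ Finset.range (s + 1), c j) z = ∑ z, c 0 z := by
  simp only [Finset.sum_apply]
  rw [Finset.sum_comm, Finset.sum_range_succ', Finset.sum_eq_zero, zero_add]
  intro j hj
  rw [Finset.mem_range] at hj
  exact sum_star_lift k (j + 1) _ (hc _) (by omega) (by omega)

lemma c_zero (k s : ℕ) (hs : s ≤ k) (c : ℕ → X 𝔽 V k → ℝ) (hc : ∀ j, c j ∈ H 𝔽 V j k)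
    (h0 : ∑ z, (∑ j ∈ Finset.range (s + 1), c j) z = 0) : c 0 = 0 := by
  rw [sum_dec k s hs c hc] at h0
  obtain ⟨a, ha⟩ := H_zero k _ (hc 0)
  funext U
  simp only [ha, Finset.sum_const, nsmul_eq_mul] at h0
  rw [ha]
  rcases mul_eq_zero.1 h0 with h | h
  · exfalso
    rw [Nat.cast_eq_zero, Finset.card_eq_zero] at h
    exact absurd (Finset.mem_univ U) (by rw [h]; simp)
  · rw [h]; rfl

/-- mean zero elements of `M` -/
lemma M_dec_zero (k s : ℕ) (hs : s ≤ k) (f : X 𝔽 V k → ℝ) (hf : f ∈ M 𝔽 V k s) (h0 : ∑ z, f z = 0) :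
    ∃ c : ℕ → X 𝔽 V k → ℝ, (∀ j, c j ∈ H 𝔽 V j k) ∧ f = ∑ j ∈ Finset.Icc 1 s, c j := by
  obtain ⟨c, hc, rfl⟩ := M_dec k s hs f hf
  refine ⟨c, hc, ?_⟩
  have := c_zero k s hs c hc h0
  rw [Finset.range_eq_Ico, Finset.sum_eq_sum_Ico_succ_bot (by omega), this, zero_add]
  rfl

lemma N_apply (k : ℕ) (g : X 𝔽 V k → ℝ) (U : X 𝔽 V k) :
    N 𝔽 V k g U = ∑ L : X 𝔽 V (k - 1), ind (L.1 ≤ U.1) * ∑ z : X 𝔽 V k, ind (L.1 ≤ z.1) * g z := rfl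

lemma finrank_inf_hyper (k : ℕ) (U L z : Submodule 𝔽 V) (hU : Module.finrank 𝔽 U = k)
    (hL : Module.finrank 𝔽 L = k - 1) (h : L ≤ U) :
    Module.finrank 𝔽 ↥(z ⊓ U) ≤ Module.finrank 𝔽 ↥(z ⊓ L) + 1 := by
  have h1 := Submodule.finrank_sup_add_finrank_inf_eq (z ⊓ U) L
  have h2 : (z ⊓ U) ⊓ L = z ⊓ L := by rw [inf_assoc, inf_eq_right.2 h]
  have h3 : Module.finrank 𝔽 ↥((z ⊓ U) ⊔ L) ≤ Module.finrank 𝔽 U :=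
    Submodule.finrank_mono (sup_le inf_le_right h)
  rw [h2] at h1
  omega

lemma loc_pow (k : ℕ) (f : X 𝔽 V k → ℝ) (i : ℕ) : ∀ U : X 𝔽 V k,
    (∀ z : X 𝔽 V k, Module.finrank 𝔽 ↥(z.1 ⊓ U.1) ≤ i → f z = 0) →
    ((N 𝔽 V k) ^ i) (K 𝔽 V k f) U = 0 := by
  induction i with
  | zero =>
    intro U h
    rw [pow_zero, Module.End.one_apply, K_apply]
    refine Finset.sum_eq_zero fun z _ => ?_
    by_cases hz : Disjoint z.1 U.1
    · rw [h z (by rw [hz.eq_bot, finrank_bot]), mul_zero]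
    · rw [ind_false hz, zero_mul]
  | succ i ih =>
    intro U h
    rw [pow_succ', Module.End.mul_apply, N_apply]
    refine Finset.sum_eq_zero fun L _ => ?_
    by_cases hL : L.1 ≤ U.1
    · rw [Finset.sum_eq_zero, mul_zero]
      intro y _
      by_cases hy : L.1 ≤ y.1
      · rw [ih y, mul_zero]
        intro z hz
        refine h z ((finrank_inf_hyper k U.1 L.1 z.1 U.2 L.2 hL).trans ?_)
        have : Module.finrank 𝔽 ↥(z.1 ⊓ L.1) ≤ Module.finrank 𝔽 ↥(z.1 ⊓ y.1) :=
          Submodule.finrank_mono (inf_le_inf_left _ hy)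
        omega
      · rw [ind_false hy, zero_mul]
    · rw [ind_false hL, zero_mul]

lemma loc_poly (k r : ℕ) (f : X 𝔽 V k → ℝ) (P : Polynomial ℝ) (hP : P.degree < r) (U : X 𝔽 V k)
    (h : ∀ z : X 𝔽 V k, Module.finrank 𝔽 ↥(z.1 ⊓ U.1) < r → f z = 0) :
    (Polynomial.aeval (N 𝔽 V k) P) (K 𝔽 V k f) U = 0 := by
  by_cases h0 : P = 0
  · rw [h0, map_zero]; rfl
  rw [Polynomial.aeval_eq_sum_range' ((Polynomial.natDegree_lt_iff_degree_lt h0).2 hP),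
    LinearMap.sum_apply, Finset.sum_apply]
  refine Finset.sum_eq_zero fun i hi => ?_
  rw [LinearMap.smul_apply, Pi.smul_apply, loc_pow k f i U, smul_zero]
  intro z hz
  rw [Finset.mem_range] at hi
  exact h z (by omega)

variable (𝔽 V) in
noncomputable abbrev th (k j : ℕ) : ℝ := theta (qq 𝔽) (Module.finrank 𝔽 V) k j
variable (𝔽 V) in
noncomputable abbrev be (k j : ℕ) : ℝ := beta (qq 𝔽) (Module.finrank 𝔽 V) k j

lemma poly_H (k j : ℕ) (hk : 1 ≤ k) (hkn : k ≤ Module.finrank 𝔽 V) (hj : j ≤ k)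
    (φ : X 𝔽 V k → ℝ) (hφ : φ ∈ H 𝔽 V j k) (P : Polynomial ℝ) :
    (Polynomial.aeval (N 𝔽 V k) P) (K 𝔽 V k φ) = (P.eval (th 𝔽 V k j) * be 𝔽 V k j) • φ := by
  rw [K_lift k j hj φ hφ, map_smul]
  by_cases h0 : φ = 0
  · rw [h0]; simp
  rw [Module.End.aeval_apply_of_hasEigenvector
    (μ := th 𝔽 V k j) ⟨Module.End.mem_eigenspace_iff.2 (N_lift k j hk hkn hj φ hφ), h0⟩, smul_smul, mul_comm]

lemma poly_sum (k : ℕ) (hk : 1 ≤ k) (hkn : k ≤ Module.finrank 𝔽 V) (J : Finset ℕ)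
    (hJ : ∀ j ∈ J, j ≤ k) (c : ℕ → X 𝔽 V k → ℝ) (hc : ∀ j, c j ∈ H 𝔽 V j k) (P : Polynomial ℝ) :
    (Polynomial.aeval (N 𝔽 V k) P) (K 𝔽 V k (∑ j ∈ J, c j))
      = ∑ j ∈ J, (P.eval (th 𝔽 V k j) * be 𝔽 V k j) • c j := by
  rw [map_sum, map_sum]
  exact Finset.sum_congr rfl fun j hj => poly_H k j hk hkn (hJ j hj) _ (hc j) P

lemma N_sum (k : ℕ) (hk : 1 ≤ k) (hkn : k ≤ Module.finrank 𝔽 V) (J : Finset ℕ)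
    (hJ : ∀ j ∈ J, j ≤ k) (c : ℕ → X 𝔽 V k → ℝ) (hc : ∀ j, c j ∈ H 𝔽 V j k) :
    N 𝔽 V k (∑ j ∈ J, c j) = ∑ j ∈ J, th 𝔽 V k j • c j := by
  rw [map_sum]
  exact Finset.sum_congr rfl fun j hj => N_lift k j hk hkn (hJ j hj) _ (hc j)

lemma theta_sub {q : ℝ} {n k j p : ℕ} (hpj : p ≤ j) (hjk : j ≤ k) (hn : 2 * k ≤ n) :
    theta q n k p - theta q n k j = (q ^ j - q ^ p) * (q ^ (n + 1 - j - p) - 1) / (q - 1) ^ 2 := by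
  unfold theta
  rw [← sub_div]
  congr 1
  obtain ⟨a, rfl⟩ := Nat.exists_eq_add_of_le hpj
  obtain ⟨b, rfl⟩ := Nat.exists_eq_add_of_le hjk
  obtain ⟨m, rfl⟩ := Nat.exists_eq_add_of_le hn
  rw [show 2 * (p + a + b) + m - (p + a + b) + 1 = p + a + b + m + 1 by omega,
    show p + a + b - p = a + b by omega, show p + a + b - (p + a) = b by omega,
    show 2 * (p + a + b) + m + 1 - (p + a) - p = a + 2 * b + m + 1 by omega]
  ring

lemma theta_lt {q : ℝ} (hq : 2 ≤ q) {n k j p : ℕ} (hpj : p < j) (hjk : j ≤ k) (hn : 2 * k ≤ n) :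
    theta q n k j < theta q n k p := by
  rw [← sub_pos, theta_sub hpj.le hjk hn]
  have h1 := pow_sub_pos hq hpj
  have h2 := pow_sub_pos hq (show 0 < n + 1 - j - p by omega)
  rw [pow_zero] at h2
  have : 0 < q - 1 := by linarith
  positivity

lemma theta_inj {q : ℝ} (hq : 2 ≤ q) {n k j p : ℕ} (hj : j ≤ k) (hp : p ≤ k) (hn : 2 * k ≤ n)
    (h : theta q n k j = theta q n k p) : j = p := by
  rcases lt_trichotomy j p with h1 | h1 | h1
  · exact absurd h (theta_lt hq h1 hp hn).ne'
  · exact h1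
  · exact absurd h (theta_lt hq h1 hj hn).ne

lemma beta_ne {q : ℝ} (hq : 2 ≤ q) {n k j : ℕ} (hn : 2 * k ≤ n) : beta q n k j ≠ 0 := by
  unfold beta mu
  refine mul_ne_zero (Finset.prod_ne_zero_iff.2 fun i _ => ?_) (cc_pos hq (by omega)).ne'
  have : 0 < q ^ i := by positivity
  linarith

lemma exists_poly {q : ℝ} (hq : 2 ≤ q) {n k : ℕ} (hn : 2 * k ≤ n) (J : Finset ℕ) (hJ : ∀ j ∈ J, j ≤ k)
    (l : ℕ → ℝ) : ∃ P : Polynomial ℝ, P.degree < J.card ∧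
      ∀ j ∈ J, P.eval (theta q n k j) * beta q n k j = l j := by
  have hinj : Set.InjOn (theta q n k) (J : Set ℕ) := fun a ha b hb h => theta_inj hq (hJ a ha) (hJ b hb) hn h
  refine ⟨Lagrange.interpolate J (theta q n k) (fun j => l j / beta q n k j),
    Lagrange.degree_interpolate_lt _ hinj, fun j hj => ?_⟩
  rw [Lagrange.eval_interpolate_at_node _ hinj hj, div_mul_cancel₀ _ (beta_ne hq hn)]

lemma transfer (k : ℕ) (hk : 1 ≤ k) (hn : 2 * k ≤ Module.finrank 𝔽 V) (J : Finset ℕ)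
    (hJ : ∀ j ∈ J, j ≤ k) (c : ℕ → X 𝔽 V k → ℝ) (hc : ∀ j, c j ∈ H 𝔽 V j k) (l : ℕ → ℝ)
    (U : X 𝔽 V k)
    (h : ∀ z : X 𝔽 V k, Module.finrank 𝔽 ↥(z.1 ⊓ U.1) < J.card → (∑ j ∈ J, c j) z = 0) :
    (∑ j ∈ J, l j • c j) U = 0 := by
  obtain ⟨P, hP, hl⟩ := exists_poly (qq_ge (𝔽 := 𝔽)) hn J hJ l
  rw [← loc_poly k _ _ P hP U h, poly_sum k hk (by omega) J hJ c hc]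
  have : ∑ j ∈ J, l j • c j = ∑ j ∈ J, (P.eval (th 𝔽 V k j) * be 𝔽 V k j) • c j :=
    Finset.sum_congr rfl fun j hj => by rw [hl j hj]
  rw [this]

lemma N_symm (k : ℕ) (f g : X 𝔽 V k → ℝ) : ∑ U, N 𝔽 V k f U * g U = ∑ U, f U * N 𝔽 V k g U := by
  simp only [N_apply, Finset.mul_sum, Finset.sum_mul]
  rw [Finset.sum_comm]
  conv_rhs => rw [Finset.sum_comm]
  refine Finset.sum_congr rfl fun L _ => ?_
  rw [Finset.sum_comm]
  refine Finset.sum_congr rfl fun U _ => Finset.sum_congr rfl fun z _ => ?_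
  ring

lemma H_orth (k i j : ℕ) (hk : 1 ≤ k) (hn : 2 * k ≤ Module.finrank 𝔽 V) (hi : i ≤ k) (hj : j ≤ k)
    (hij : i ≠ j) (f g : X 𝔽 V k → ℝ) (hf : f ∈ H 𝔽 V i k) (hg : g ∈ H 𝔽 V j k) :
    ∑ U, f U * g U = 0 := by
  have h := N_symm k f g
  rw [N_lift k i hk (by omega) hi f hf, N_lift k j hk (by omega) hj g hg] at h
  simp only [Pi.smul_apply, smul_eq_mul] at h
  simp only [mul_left_comm (f _), mul_assoc] at h
  rw [← Finset.mul_sum, ← Finset.mul_sum, ← sub_eq_zero, ← sub_mul] at h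
  rcases mul_eq_zero.1 h with h1 | h1
  · exact absurd (theta_inj qq_ge hi hj hn (sub_eq_zero.1 h1)) hij
  · exact h1

end dec

end EKRq

end partC

section partD
open Classical Finset

namespace EKRq

section pos

lemma beta_succ {q : ℝ} (hq : 2 ≤ q) {n k a : ℕ} (ha : a < k) (hn : 2 * k ≤ n) :
    ∃ r : ℝ, 0 < r ∧ r * q ^ (k - a) ≤ 1 ∧ beta q n k (a + 1) = - r * beta q n k a := by
  have h1 := pow_sub_pos hq ha
  have h2 : 0 < q ^ n - q ^ (k + a) := pow_sub_pos hq (by omega)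
  have hq0 : 0 < q := by linarith
  refine ⟨q ^ a * (q ^ k - q ^ a) / (q ^ n - q ^ (k + a)), by positivity, ?_, ?_⟩
  · rw [div_mul_eq_mul_div, div_le_one h2]
    have e1 : q ^ a * (q ^ k - q ^ a) * q ^ (k - a) = q ^ (2 * k) - q ^ (k + a) := by
      obtain ⟨b, rfl⟩ := Nat.exists_eq_add_of_le ha.le
      rw [Nat.add_sub_cancel_left]; ring
    have e2 : q ^ (2 * k) ≤ q ^ n := pow_le_pow_right₀ (by linarith) hn
    linarith
  · unfold beta
    rw [cc_succ q n k a k ha]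
    unfold mu
    rw [Finset.prod_range_succ]
    field_simp

lemma beta_abs {q : ℝ} (hq : 2 ≤ q) {n k a b : ℕ} (hb : 1 ≤ b) (ha : a + b ≤ k) (hn : 2 * k ≤ n) :
    |beta q n k (a + 1)| * 2 ^ b ≤ |beta q n k a| := by
  obtain ⟨r, hr, h1, h2⟩ := beta_succ hq (show a < k by omega) hn
  rw [h2, abs_mul, abs_neg, abs_of_pos hr]
  have h3 : (2 : ℝ) ^ b ≤ q ^ (k - a) :=
    (pow_le_pow_left₀ (by norm_num) hq b).trans (pow_le_pow_right₀ (by linarith) (by omega))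
  have h4 : r * 2 ^ b ≤ 1 := (mul_le_mul_of_nonneg_left h3 hr.le).trans h1
  have := abs_nonneg (beta q n k a)
  nlinarith

lemma beta_far {q : ℝ} (hq : 2 ≤ q) {n k : ℕ} (hn : 2 * k ≤ n) (d : ℕ) : ∀ l, l + (d + 2) ≤ k →
    |beta q n k (l + (d + 2))| * 2 ^ (d + 3) ≤ |beta q n k l| := by
  induction d with
  | zero =>
    intro l hl
    have h1 := beta_abs hq (a := l) (b := 2) (by norm_num) hl hn
    have h2 := beta_abs hq (a := l + 1) (b := 1) (by norm_num) (by omega) hn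
    rw [show l + 1 + 1 = l + (0 + 2) by omega] at h2
    norm_num at *
    linarith
  | succ d ih =>
    intro l hl
    have h1 := beta_abs hq (a := l) (b := 1) (by norm_num) (by omega) hn
    have h2 := ih (l + 1) (by omega)
    rw [show l + 1 + (d + 2) = l + (d + 1 + 2) by omega] at h2
    rw [show d + 1 + 3 = (d + 3) + 1 by omega, pow_succ]
    linarith

lemma prod_half (N : ℕ) : (1 : ℝ) / 4 + 1 / 2 ^ (N + 2)
    ≤ ∏ x ∈ Finset.Ico 1 (N + 2), (1 - 1 / 2 ^ x) := by
  induction N with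
  | zero => simp; norm_num
  | succ N ih =>
    rw [Finset.prod_Ico_succ_top (by omega)]
    have h3 : (1 : ℝ) / 2 ^ (N + 2) ≤ 1 / 4 := by
      have : (2 : ℝ) ^ 2 ≤ 2 ^ (N + 2) := pow_le_pow_right₀ (by norm_num) (by omega)
      rw [div_le_div_iff₀ (by positivity) (by norm_num)]
      linarith
    have h5 : (1 : ℝ) / 2 ^ (N + 1 + 2) = (1 / 2 ^ (N + 2)) / 2 := by
      rw [pow_succ _ (N + 2)]; field_simp
    have h4 : (0 : ℝ) < 1 / 2 ^ (N + 2) := by positivity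
    rw [h5]
    rw [show N + 1 + 1 = N + 2 by omega]
    generalize (1 : ℝ) / 2 ^ (N + 2) = x at *
    nlinarith

lemma prod_half' (l : ℕ) : (1 : ℝ) / 4 ≤ ∏ x ∈ Finset.Ico 1 l, (1 - 1 / 2 ^ x) := by
  rcases Nat.lt_or_ge l 2 with h | h
  · rw [Finset.Ico_eq_empty_of_le (by omega)]; norm_num
  · obtain ⟨N, rfl⟩ : ∃ N, l = N + 2 := ⟨l - 2, by omega⟩
    refine le_trans ?_ (prod_half N)
    have : (0 : ℝ) < 1 / 2 ^ (N + 2) := by positivity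
    linarith

lemma theta_s {q : ℝ} {n k j p : ℕ} (hpj : p ≤ j) (hjk : j ≤ k) (hn : 2 * k ≤ n) :
    theta q n k p - theta q n k j
      = (q ^ (n + 1 - p) + q ^ p - q ^ (n + 1 - j) - q ^ j) / (q - 1) ^ 2 := by
  rw [theta_sub hpj hjk hn]
  congr 1
  obtain ⟨a, rfl⟩ := Nat.exists_eq_add_of_le hpj
  obtain ⟨b, rfl⟩ := Nat.exists_eq_add_of_le hjk
  obtain ⟨m, rfl⟩ := Nat.exists_eq_add_of_le hn
  rw [show 2 * (p + a + b) + m + 1 - (p + a) - p = a + 2 * b + m + 1 by omega,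
    show 2 * (p + a + b) + m + 1 - p = p + 2 * a + 2 * b + m + 1 by omega,
    show 2 * (p + a + b) + m + 1 - (p + a) = p + a + 2 * b + m + 1 by omega]
  ring

/-- factor for `l < p` -/
lemma fac_gt {q : ℝ} (hq : 2 ≤ q) {n k j l p : ℕ} (hlp : l < p) (hpj : p < j) (hjk : j ≤ k)
    (hn : 2 * k ≤ n) :
    |(theta q n k j - theta q n k p) / (theta q n k l - theta q n k p)| ≤ 1 := by
  have h1 := theta_lt hq hpj hjk hn
  have h2 := theta_lt hq hlp (show p ≤ k by omega) hn
  rw [abs_div, abs_of_neg (by linarith), abs_of_pos (by linarith), div_le_one (by linarith), neg_sub,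
    theta_s hpj.le hjk hn, theta_s hlp.le (by omega) hn]
  have hq1 : 0 < (q - 1) ^ 2 := by
    have : 0 < q - 1 := by linarith
    positivity
  rw [div_le_div_iff_of_pos_right hq1]
  have a1 : 2 * q ^ (n + 1 - p) ≤ q ^ (n + 1 - l) := by
    have : q ^ (n + 1 - p + 1) ≤ q ^ (n + 1 - l) := pow_le_pow_right₀ (by linarith) (by omega)
    have h0 : 0 < q ^ (n + 1 - p) := by positivity
    rw [pow_succ] at this
    nlinarith
  have a2 : 2 * q ^ p ≤ q ^ j := by
    have : q ^ (p + 1) ≤ q ^ j := pow_le_pow_right₀ (by linarith) (by omega)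
    have h0 : 0 < q ^ p := by positivity
    rw [pow_succ] at this
    nlinarith
  have h3 : 0 < q ^ l := by positivity
  have h4 : 0 < q ^ (n + 1 - j) := by positivity
  linarith

/-- factor for `p < l` -/
lemma fac_lt {q : ℝ} (hq : 2 ≤ q) {n k j l p : ℕ} (hpl : p < l) (hlj : l < j) (hjk : j ≤ k)
    (hn : 2 * k ≤ n) :
    0 < (theta q n k j - theta q n k p) / (theta q n k l - theta q n k p) ∧
    (theta q n k j - theta q n k p) / (theta q n k l - theta q n k p) * (1 - 1 / 2 ^ (l - p)) ≤ 1 := by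
  have h1 := theta_lt hq (hpl.trans hlj) hjk hn
  have h2 := theta_lt hq hpl (show l ≤ k by omega) hn
  have hq1 : 0 < (q - 1) ^ 2 := by
    have : 0 < q - 1 := by linarith
    positivity
  have e : (theta q n k j - theta q n k p) / (theta q n k l - theta q n k p)
    = (theta q n k p - theta q n k j) / (theta q n k p - theta q n k l) := by
    rw [← neg_div_neg_eq, neg_sub, neg_sub]
  rw [e]
  have p1 : 0 < theta q n k p - theta q n k j := by linarith
  have p2 : 0 < theta q n k p - theta q n k l := by linarith
  refine ⟨by positivity, ?_⟩
  rw [div_mul_eq_mul_div, div_le_one p2]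
  have b1 : (1 : ℝ) - 1 / 2 ^ (l - p) ≤ 1 - 1 / q ^ (l - p) := by
    have : (2 : ℝ) ^ (l - p) ≤ q ^ (l - p) := pow_le_pow_left₀ (by norm_num) hq _
    have := one_div_le_one_div_of_le (by positivity) this
    linarith
  refine (mul_le_mul_of_nonneg_left b1 p1.le).trans ?_
  rw [theta_s (hpl.trans hlj).le hjk hn, theta_sub hpl.le (by omega) hn, div_mul_eq_mul_div,
    div_le_div_iff_of_pos_right hq1]
  have c1 : q ^ l * (1 - 1 / q ^ (l - p)) = q ^ l - q ^ p := by
    obtain ⟨a, rfl⟩ := Nat.exists_eq_add_of_le hpl.le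
    rw [Nat.add_sub_cancel_left, pow_add]; field_simp
  rw [← c1, mul_right_comm]
  refine mul_le_mul_of_nonneg_right ?_ ?_
  · have c2 : q ^ l * (q ^ (n + 1 - l - p) - 1) = q ^ (n + 1 - p) - q ^ l := by
      rw [mul_sub, ← pow_add, mul_one, show l + (n + 1 - l - p) = n + 1 - p by omega]
    have c3 : q ^ l ≤ q ^ j := pow_le_pow_right₀ (by linarith) hlj.le
    have c4 : q ^ p ≤ q ^ (n + 1 - j) := pow_le_pow_right₀ (by linarith) (by omega)
    rw [c2]; linarith
  · rw [sub_nonneg, div_le_one (by positivity)]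
    exact one_le_pow₀ (by linarith)

noncomputable def Pol (q : ℝ) (n k t : ℕ) : Polynomial ℝ :=
  Lagrange.interpolate (Finset.Icc 1 t) (theta q n k) (fun l => - 1 / beta q n k l)

noncomputable def lam (q : ℝ) (n k t j : ℕ) : ℝ := 1 + (Pol q n k t).eval (theta q n k j) * beta q n k j

lemma Pol_inj {q : ℝ} (hq : 2 ≤ q) {n k t : ℕ} (hn : 2 * k ≤ n) (ht : t ≤ k) :
    Set.InjOn (theta q n k) (Finset.Icc 1 t : Set ℕ) := by
  intro a ha b hb h
  simp only [Finset.coe_Icc, Set.mem_Icc] at ha hb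
  exact theta_inj hq (by omega) (by omega) hn h

lemma Pol_degree {q : ℝ} (hq : 2 ≤ q) {n k t : ℕ} (hn : 2 * k ≤ n) (ht : t ≤ k) :
    (Pol q n k t).degree < t := by
  have := Lagrange.degree_interpolate_lt (fun l => - 1 / beta q n k l) (Pol_inj hq hn ht)
  rwa [Nat.card_Icc, Nat.add_sub_cancel] at this

lemma lam_zero {q : ℝ} (hq : 2 ≤ q) {n k t j : ℕ} (hn : 2 * k ≤ n) (ht : t ≤ k) (hj : 1 ≤ j)
    (hjt : j ≤ t) : lam q n k t j = 0 := by
  unfold lam Pol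
  rw [Lagrange.eval_interpolate_at_node _ (Pol_inj hq hn ht) (Finset.mem_Icc.2 ⟨hj, hjt⟩),
    div_mul_cancel₀ _ (beta_ne hq hn)]
  norm_num

lemma lam_eq (q : ℝ) (n k t j : ℕ) : lam q n k t j = 1 - ∑ l ∈ Finset.Icc 1 t,
    beta q n k j / beta q n k l * ∏ p ∈ (Finset.Icc 1 t).erase l,
      ((theta q n k j - theta q n k p) / (theta q n k l - theta q n k p)) := by
  unfold lam Pol
  rw [Lagrange.interpolate_apply, Polynomial.eval_finsetSum, Finset.sum_mul, sub_eq_add_neg,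
    ← Finset.sum_neg_distrib]
  congr 1
  refine Finset.sum_congr rfl fun l _ => ?_
  rw [Polynomial.eval_mul, Polynomial.eval_C, Lagrange.basis, Polynomial.eval_prod]
  have : ∀ p, Polynomial.eval (theta q n k j) (Lagrange.basisDivisor (theta q n k l) (theta q n k p))
      = (theta q n k j - theta q n k p) / (theta q n k l - theta q n k p) := by
    intro p
    simp [Lagrange.basisDivisor]
    ring
  rw [Finset.prod_congr rfl fun p _ => this p]
  ring

lemma erase_split {t l : ℕ} (h1 : 1 ≤ l) (h2 : l ≤ t) (f : ℕ → ℝ) :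
    ∏ p ∈ (Finset.Icc 1 t).erase l, f p = (∏ p ∈ Finset.Ico 1 l, f p) * ∏ p ∈ Finset.Ioc l t, f p := by
  rw [← Finset.prod_union]
  · congr 1
    ext p
    simp only [Finset.mem_erase, Finset.mem_Icc, Finset.mem_union, Finset.mem_Ico, Finset.mem_Ioc]
    omega
  · rw [Finset.disjoint_left]
    intro p
    simp only [Finset.mem_Ico, Finset.mem_Ioc]
    omega

lemma prod_low {q : ℝ} (hq : 2 ≤ q) {n k j l : ℕ} (hlj : l < j) (hjk : j ≤ k) (hn : 2 * k ≤ n) :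
    0 < (∏ p ∈ Finset.Ico 1 l, ((theta q n k j - theta q n k p) / (theta q n k l - theta q n k p))) ∧
    (∏ p ∈ Finset.Ico 1 l, ((theta q n k j - theta q n k p) / (theta q n k l - theta q n k p))) ≤ 4 := by
  have h0 : 0 < (∏ p ∈ Finset.Ico 1 l, ((theta q n k j - theta q n k p) / (theta q n k l - theta q n k p))) :=
    Finset.prod_pos fun p hp => (fac_lt hq (Finset.mem_Ico.1 hp).2 hlj hjk hn).1
  refine ⟨h0, ?_⟩
  have h1 : ∏ p ∈ Finset.Ico 1 l, ((1 : ℝ) - 1 / 2 ^ (l - p)) = ∏ x ∈ Finset.Ico 1 l, (1 - 1 / 2 ^ x) := by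
    refine Finset.prod_nbij' (fun p => l - p) (fun p => l - p) ?_ ?_ ?_ ?_ ?_
    · intro a ha; simp only [Finset.mem_Ico] at *; omega
    · intro a ha; simp only [Finset.mem_Ico] at *; omega
    · intro a ha; simp only [Finset.mem_Ico] at *; omega
    · intro a ha; simp only [Finset.mem_Ico] at *; omega
    · intro a ha; rfl
  have h2 := prod_half' l
  rw [← h1] at h2
  have h3 : (∏ p ∈ Finset.Ico 1 l, ((theta q n k j - theta q n k p) / (theta q n k l - theta q n k p)))
      * ∏ p ∈ Finset.Ico 1 l, ((1 : ℝ) - 1 / 2 ^ (l - p)) ≤ 1 := by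
    rw [← Finset.prod_mul_distrib]
    refine Finset.prod_le_one ?_ fun p hp => (fac_lt hq (Finset.mem_Ico.1 hp).2 hlj hjk hn).2
    intro p hp
    refine mul_nonneg (fac_lt hq (Finset.mem_Ico.1 hp).2 hlj hjk hn).1.le ?_
    rw [sub_nonneg, div_le_one (by positivity)]
    exact one_le_pow₀ (by norm_num)
  nlinarith

lemma term_le {q : ℝ} (hq : 2 ≤ q) {n k t j l : ℕ} (hn : 2 * k ≤ n) (hjk : j ≤ k) (htj : t < j)
    (hl1 : 1 ≤ l) (hlt : l ≤ t) :
    beta q n k j / beta q n k l * ∏ p ∈ (Finset.Icc 1 t).erase l,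
      ((theta q n k j - theta q n k p) / (theta q n k l - theta q n k p))
      ≤ if l < j - 1 then (2 : ℝ) ^ l / 2 ^ (j - 1) else 0 := by
  rw [erase_split hl1 hlt]
  obtain ⟨p0, p4⟩ := prod_low hq (show l < j by omega) hjk hn
  have hb := beta_ne hq hn (j := l)
  split_ifs with hc
  · refine (le_abs_self _).trans ?_
    rw [abs_mul, abs_mul, abs_div, abs_of_pos p0, Finset.abs_prod]
    have h1 : ∏ p ∈ Finset.Ioc l t, |(theta q n k j - theta q n k p) / (theta q n k l - theta q n k p)| ≤ 1 := by
      refine Finset.prod_le_one (fun _ _ => abs_nonneg _) fun p hp => ?_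
      rw [Finset.mem_Ioc] at hp
      exact fac_gt hq hp.1 (by omega) hjk hn
    obtain ⟨d, rfl⟩ : ∃ d, j = l + (d + 2) := ⟨j - l - 2, by omega⟩
    have h2 := beta_far hq hn d l hjk
    have hb' : 0 < |beta q n k l| := abs_pos.2 hb
    have h3 : |beta q n k (l + (d + 2))| / |beta q n k l| ≤ 1 / 2 ^ (d + 3) := by
      rw [div_le_div_iff₀ hb' (by positivity)]; linarith
    have h4 : (2 : ℝ) ^ l / 2 ^ (l + (d + 2) - 1) = 1 / 2 ^ (d + 3) * (4 * 1) := by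
      rw [show l + (d + 2) - 1 = l + d + 1 by omega]
      field_simp
      ring
    rw [h4]
    refine mul_le_mul h3 ?_ (by positivity) (by positivity)
    exact mul_le_mul p4 h1 (Finset.prod_nonneg fun _ _ => abs_nonneg _) (by norm_num)
  · have : j = l + 1 := by omega
    subst this
    have : t = l := by omega
    subst this
    rw [Finset.Ioc_self, Finset.prod_empty, mul_one]
    refine mul_nonpos_of_nonpos_of_nonneg ?_ p0.le
    obtain ⟨r, hr, _, h2⟩ := beta_succ hq (show t < k by omega) hn
    rw [h2, mul_div_assoc, div_self hb]
    linarith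

lemma lam_pos {q : ℝ} (hq : 2 ≤ q) {n k t j : ℕ} (hn : 2 * k ≤ n) (hjk : j ≤ k) (htj : t < j) :
    0 < lam q n k t j := by
  rw [lam_eq, sub_pos]
  refine (Finset.sum_le_sum fun l hl => term_le hq hn hjk htj (Finset.mem_Icc.1 hl).1 (Finset.mem_Icc.1 hl).2).trans_lt ?_
  have h1 : ∑ l ∈ Finset.Icc 1 t, (if l < j - 1 then (2 : ℝ) ^ l / 2 ^ (j - 1) else 0)
      ≤ ∑ l ∈ Finset.range j, (if l < j - 1 then (2 : ℝ) ^ l / 2 ^ (j - 1) else 0) := by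
    refine Finset.sum_le_sum_of_subset_of_nonneg ?_ ?_
    · intro a ha; simp only [Finset.mem_Icc, Finset.mem_range] at *; omega
    · intro a _ _; split_ifs <;> positivity
  refine h1.trans_lt ?_
  obtain ⟨i, rfl⟩ : ∃ i, j = i + 1 := ⟨j - 1, by omega⟩
  rw [Finset.sum_range_succ, Nat.add_sub_cancel, if_neg (lt_irrefl _), add_zero]
  rw [Finset.sum_congr rfl fun l hl => if_pos (Finset.mem_range.1 hl), ← Finset.sum_div, div_lt_one (by positivity)]
  rw [geom_sum_eq (by norm_num)]
  norm_num

end pos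

end EKRq

end partD

section partE
open Classical Finset

namespace EKRq

set_option linter.unusedSectionVars false

section bound

variable {𝔽 V : Type*} [Field 𝔽] [Fintype 𝔽] [AddCommGroup V] [Module 𝔽 V] [Fintype V]

noncomputable def chi {k : ℕ} (F : Finset (X 𝔽 V k)) : X 𝔽 V k → ℝ := fun z => ind (z ∈ F)

lemma chi_sum {k : ℕ} (F : Finset (X 𝔽 V k)) : ∑ z, chi F z = F.card := by
  have : ∀ z, chi F z = if z ∈ F then (1 : ℝ) else 0 := fun z => by
    unfold chi ind
    by_cases h : z ∈ F <;> simp [h]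
  rw [Finset.sum_congr rfl fun z _ => this z, Finset.sum_boole]
  simp

def TInt {k : ℕ} (t : ℕ) (F : Finset (X 𝔽 V k)) : Prop :=
  ∀ U ∈ F, ∀ z ∈ F, t ≤ Module.finrank 𝔽 ↥(z.1 ⊓ U.1)

variable (𝔽 V) in
noncomputable abbrev la (k t j : ℕ) : ℝ := lam (qq 𝔽) (Module.finrank 𝔽 V) k t j

variable (𝔽 V) in
noncomputable abbrev Po (k t : ℕ) : Polynomial ℝ := Pol (qq 𝔽) (Module.finrank 𝔽 V) k t

lemma Q_sum (k t : ℕ) (hk : 1 ≤ k) (hn : 2 * k ≤ Module.finrank 𝔽 V) (J : Finset ℕ)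
    (hJ : ∀ j ∈ J, j ≤ k) (c : ℕ → X 𝔽 V k → ℝ) (hc : ∀ j, c j ∈ H 𝔽 V j k) :
    (∑ j ∈ J, c j) + (Polynomial.aeval (N 𝔽 V k) (Po 𝔽 V k t)) (K 𝔽 V k (∑ j ∈ J, c j))
      = ∑ j ∈ J, la 𝔽 V k t j • c j := by
  rw [poly_sum k hk (by omega) J hJ c hc, ← Finset.sum_add_distrib]
  refine Finset.sum_congr rfl fun j _ => ?_
  unfold la lam
  rw [add_smul, one_smul]

/-- local vanishing of `Q` -/
lemma Q_loc (k t : ℕ) (hk : 1 ≤ k) (htk : t ≤ k) (hn : 2 * k ≤ Module.finrank 𝔽 V) (J : Finset ℕ)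
    (hJ : ∀ j ∈ J, j ≤ k) (c : ℕ → X 𝔽 V k → ℝ) (hc : ∀ j, c j ∈ H 𝔽 V j k) (U : X 𝔽 V k)
    (h : ∀ z : X 𝔽 V k, Module.finrank 𝔽 ↥(z.1 ⊓ U.1) < t → (∑ j ∈ J, c j) z = 0) :
    (∑ j ∈ J, c j) U = ∑ j ∈ J, la 𝔽 V k t j * c j U := by
  have h1 := congrFun (Q_sum k t hk hn J hJ c hc) U
  rw [Pi.add_apply, loc_poly k t _ _ (Pol_degree qq_ge hn htk) U h, add_zero] at h1
  rw [h1, Finset.sum_apply]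
  rfl

lemma energy (k t s : ℕ) (hk : 1 ≤ k) (htk : t ≤ k) (hs : s ≤ k) (hn : 2 * k ≤ Module.finrank 𝔽 V)
    (F : Finset (X 𝔽 V k)) (hF : TInt t F) (c : ℕ → X 𝔽 V k → ℝ) (hc : ∀ j, c j ∈ H 𝔽 V j k)
    (hf : chi F = ∑ j ∈ Finset.range (s + 1), c j) :
    (F.card : ℝ) = ∑ j ∈ Finset.range (s + 1), la 𝔽 V k t j * ∑ U, c j U ^ 2 := by
  have hJ : ∀ j ∈ Finset.range (s + 1), j ≤ k := fun j hj => by rw [Finset.mem_range] at hj; omega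
  have h1 : ∀ U, chi F U = chi F U * ∑ j ∈ Finset.range (s + 1), la 𝔽 V k t j * c j U := by
    intro U
    by_cases hU : U ∈ F
    · have : chi F U = 1 := ind_true hU
      rw [← Q_loc k t hk htk hn _ hJ c hc U, ← hf, this, mul_one]
      intro z hz
      rw [← hf]
      exact ind_false fun h => absurd (hF U hU z h) (by omega)
    · have : chi F U = 0 := ind_false hU
      rw [this, zero_mul]
  rw [← chi_sum, Finset.sum_congr rfl fun U _ => h1 U]
  simp only [Finset.mul_sum]
  rw [Finset.sum_comm]
  refine Finset.sum_congr rfl fun j hj => ?_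
  have h2 : ∑ U, chi F U * c j U = ∑ U, c j U ^ 2 := by
    rw [hf]
    simp only [Finset.sum_apply, Finset.sum_mul]
    rw [Finset.sum_comm, Finset.sum_eq_single j]
    · exact Finset.sum_congr rfl fun U _ => by ring
    · intro i hi hij
      exact H_orth k i j hk hn (hJ i hi) (hJ j hj) hij _ _ (hc i) (hc j)
    · intro h; exact absurd hj h
  rw [← Finset.mul_sum, ← h2, Finset.mul_sum]
  exact Finset.sum_congr rfl fun U _ => by ring

lemma exists_X (t : ℕ) (ht : t ≤ Module.finrank 𝔽 V) : ∃ T : Submodule 𝔽 V, Module.finrank 𝔽 T = t := by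
  by_contra h
  have h1 := cnt_ge (𝔽 := 𝔽) (V := V) t 0 ⊥ (finrank_bot 𝔽 V) (Nat.zero_le _)
  have h2 : (0 : ℝ) < cc (qq 𝔽) (Module.finrank 𝔽 V) 0 0 t := cc_pos qq_ge (by omega)
  rw [← h1, Finset.sum_eq_zero] at h2
  · exact lt_irrefl _ h2
  · intro z _
    exact absurd ⟨z.1, z.2⟩ h

noncomputable def starF (k : ℕ) (T : Submodule 𝔽 V) : Finset (X 𝔽 V k) := Finset.univ.filter fun z => T ≤ z.1

lemma mem_starF {k : ℕ} {T : Submodule 𝔽 V} {z : X 𝔽 V k} : z ∈ starF k T ↔ T ≤ z.1 := by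
  simp [starF]

lemma chi_starF (k : ℕ) (T : Submodule 𝔽 V) : chi (starF k T) = star k T := by
  funext z
  exact ind_congr mem_starF

lemma card_starF (k t : ℕ) (T : Submodule 𝔽 V) (hT : Module.finrank 𝔽 T = t) (htk : t ≤ k) :
    ((starF k T).card : ℝ) = cc (qq 𝔽) (Module.finrank 𝔽 V) 0 t k := by
  rw [← chi_sum, chi_starF, ← cnt_ge k t T hT htk]; rfl

lemma star_mem_M (k t : ℕ) (T : Submodule 𝔽 V) (hT : Module.finrank 𝔽 T ≤ t) : star k T ∈ M 𝔽 V k t :=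
  Submodule.subset_span ⟨T, hT, rfl⟩

lemma c0_sq (k s : ℕ) (hs : s ≤ k) (F : Finset (X 𝔽 V k)) (c : ℕ → X 𝔽 V k → ℝ)
    (hc : ∀ j, c j ∈ H 𝔽 V j k) (hf : chi F = ∑ j ∈ Finset.range (s + 1), c j)
    (hX : (0 : ℝ) < Fintype.card (X 𝔽 V k)) :
    ∑ U, c 0 U ^ 2 = (F.card : ℝ) ^ 2 / Fintype.card (X 𝔽 V k) := by
  have h1 := sum_dec k s hs c hc
  rw [← hf, chi_sum] at h1
  obtain ⟨a, ha⟩ := H_zero k _ (hc 0)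
  simp only [ha, Finset.sum_const, nsmul_eq_mul, Finset.card_univ] at *
  rw [h1]
  field_simp

theorem ekr_bound (k t : ℕ) (hk : 1 ≤ k) (htk : t ≤ k) (hn : 2 * k ≤ Module.finrank 𝔽 V)
    (F : Finset (X 𝔽 V k)) (hF : TInt t F) :
    (F.card : ℝ) ≤ cc (qq 𝔽) (Module.finrank 𝔽 V) 0 t k ∧
    ((F.card : ℝ) = cc (qq 𝔽) (Module.finrank 𝔽 V) 0 t k → chi F ∈ M 𝔽 V k t) := by
  obtain ⟨T, hT⟩ := exists_X (𝔽 := 𝔽) (V := V) t (by omega)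
  obtain ⟨C, hC⟩ : ∃ C, C = cc (qq 𝔽) (Module.finrank 𝔽 V) 0 t k := ⟨_, rfl⟩
  have hCpos : 0 < C := by rw [hC]; exact cc_pos qq_ge (by omega)
  have hX : (0 : ℝ) < Fintype.card (X 𝔽 V k) := by
    obtain ⟨U, hU⟩ := exists_X (𝔽 := 𝔽) (V := V) k (by omega)
    exact Nat.cast_pos.2 (Fintype.card_pos_iff.2 ⟨⟨U, hU⟩⟩)
  have hcard := card_starF k t T hT htk
  rw [← hC] at hcard ⊢
  have hl0 : la 𝔽 V k t 0 = Fintype.card (X 𝔽 V k) / C := by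
    obtain ⟨c, hc, hf⟩ := M_dec k t htk _ (star_mem_M k t T hT.le)
    rw [← chi_starF] at hf
    have hti : TInt t (starF k T) := by
      intro U hU z hz
      rw [mem_starF] at hU hz
      rw [← hT]
      exact Submodule.finrank_mono (le_inf hz hU)
    have h1 := energy k t t hk htk htk hn _ hti c hc hf
    rw [Finset.sum_range_succ', Finset.sum_eq_zero, zero_add, c0_sq k t htk _ c hc hf hX, hcard] at h1
    · field_simp at h1 ⊢
      linarith
    · intro j hj
      rw [Finset.mem_range] at hj
      rw [la, lam_zero qq_ge hn htk (by omega) (by omega), zero_mul]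
  obtain ⟨c, hc, hf⟩ := M_dec k k le_rfl (chi F) (mem_M_top k _)
  have h1 := energy k t k hk htk le_rfl hn F hF c hc hf
  rw [Finset.sum_range_succ', c0_sq k k le_rfl _ c hc hf hX, hl0] at h1
  obtain ⟨x, hx⟩ : ∃ x : ℝ, x = F.card := ⟨_, rfl⟩
  have hx0 : 0 ≤ x := by rw [hx]; positivity
  rw [← hx] at h1 ⊢
  have hnn : ∀ j ∈ Finset.range k, 0 ≤ la 𝔽 V k t (j + 1) * ∑ U, c (j + 1) U ^ 2 := by
    intro j hj
    rw [Finset.mem_range] at hj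
    refine mul_nonneg ?_ (Finset.sum_nonneg fun _ _ => sq_nonneg _)
    rcases Nat.lt_or_ge t (j + 1) with h | h
    · exact (lam_pos qq_ge hn (by omega) h).le
    · exact (lam_zero qq_ge hn htk (by omega) h).ge
  have hR := Finset.sum_nonneg hnn
  obtain ⟨R, hRe⟩ : ∃ R, R = ∑ j ∈ Finset.range k, la 𝔽 V k t (j + 1) * ∑ U, c (j + 1) U ^ 2 := ⟨_, rfl⟩
  rw [← hRe] at h1 hR
  have h2 : (Fintype.card (X 𝔽 V k) : ℝ) / C * (x ^ 2 / Fintype.card (X 𝔽 V k)) = x ^ 2 / C := by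
    field_simp
  rw [h2] at h1
  have h3 : x * C = R * C + x ^ 2 := by
    field_simp at h1; linarith
  refine ⟨?_, fun h => ?_⟩
  · by_contra hlt
    push Not at hlt
    nlinarith
  · have hR0 : R = 0 := by
      rw [h] at h3
      have : R * C = 0 := by nlinarith
      exact (mul_eq_zero.1 this).resolve_right hCpos.ne'
    rw [hRe, Finset.sum_eq_zero_iff_of_nonneg hnn] at hR0
    rw [hf]
    refine Submodule.sum_mem _ fun j hj => ?_
    rw [Finset.mem_range] at hj
    rcases Nat.lt_or_ge t j with h5 | h5
    · obtain ⟨i, rfl⟩ : ∃ i, j = i + 1 := ⟨j - 1, by omega⟩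
      have h6 := (mul_eq_zero.1 (hR0 i (Finset.mem_range.2 (by omega)))).resolve_left
        (lam_pos qq_ge hn (by omega) h5).ne'
      rw [Finset.sum_eq_zero_iff_of_nonneg fun _ _ => sq_nonneg _] at h6
      have : c (i + 1) = 0 := by
        funext U
        exact pow_eq_zero_iff (two_ne_zero) |>.1 (h6 U (Finset.mem_univ _))
      rw [this]; exact Submodule.zero_mem _
    · exact M_mono k h5 (H_le_M k j (hc j))

end bound

end EKRq

end partE

section partF1
open Classical Finset

namespace EKRq

set_option linter.unusedSectionVars false

section lin

variable {𝔽 V : Type*} [Field 𝔽] [Fintype 𝔽] [AddCommGroup V] [Module 𝔽 V] [Fintype V]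

lemma hyper_finrank (U : Submodule 𝔽 V) (f : V →ₗ[𝔽] 𝔽) (x : V) (hx : x ∈ U) (hf : f x ≠ 0) :
    Module.finrank 𝔽 ↥(U ⊓ LinearMap.ker f) + 1 = Module.finrank 𝔽 U := by
  have h1 : x ∉ U ⊓ LinearMap.ker f := fun h => hf h.2
  rw [← finrank_sup_span h1]
  have : (U ⊓ LinearMap.ker f) ⊔ Submodule.span 𝔽 {x} = U := by
    refine le_antisymm (sup_le inf_le_left (by rwa [Submodule.span_singleton_le_iff_mem])) ?_
    intro u hu
    rw [Submodule.mem_sup]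
    refine ⟨u - (f u / f x) • x, ⟨U.sub_mem hu (U.smul_mem _ hx), ?_⟩, (f u / f x) • x,
      Submodule.smul_mem _ _ (Submodule.mem_span_singleton_self x), by abel⟩
    rw [SetLike.mem_coe, LinearMap.mem_ker, map_sub, map_smul, smul_eq_mul, div_mul_cancel₀ _ hf, sub_self]
  rw [this]

lemma exists_avoid (S A B : Submodule 𝔽 V) (hA : ¬ S ≤ A) (hB : ¬ S ≤ B) :
    ∃ v ∈ S, v ∉ A ∧ v ∉ B := by
  obtain ⟨a, haS, ha⟩ := SetLike.not_le_iff_exists.1 hA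
  obtain ⟨b, hbS, hb⟩ := SetLike.not_le_iff_exists.1 hB
  by_cases h1 : a ∈ B
  · by_cases h2 : b ∈ A
    · refine ⟨a + b, S.add_mem haS hbS, fun h => ha ?_, fun h => hb ?_⟩
      · simpa using A.sub_mem h h2
      · simpa using B.sub_mem h h1
    · exact ⟨b, hbS, h2, hb⟩
  · exact ⟨a, haS, ha, h1⟩

lemma exists_dual (T : Submodule 𝔽 V) (x : V) (hx : x ∉ T) :
    ∃ f : V →ₗ[𝔽] 𝔽, f x ≠ 0 ∧ T ≤ LinearMap.ker f := by
  obtain ⟨f, h1, h2⟩ := Submodule.exists_le_ker_of_notMem hx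
  exact ⟨f, h1, h2⟩

lemma exists_dual_two (x y : V) (hx : x ≠ 0) (hy : y ≠ 0) :
    ∃ f : V →ₗ[𝔽] 𝔽, f x ≠ 0 ∧ f y ≠ 0 := by
  obtain ⟨f, hf, _⟩ := exists_dual (𝔽 := 𝔽) ⊥ x (by simpa using hx)
  obtain ⟨g, hg, _⟩ := exists_dual (𝔽 := 𝔽) ⊥ y (by simpa using hy)
  by_cases h1 : f y = 0
  · by_cases h2 : g x = 0
    · refine ⟨f + g, ?_, ?_⟩
      · rwa [LinearMap.add_apply, h2, add_zero]
      · rwa [LinearMap.add_apply, h1, zero_add]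
    · exact ⟨g, h2, hg⟩
  · exact ⟨f, hf, h1⟩

lemma sup_span_inf (H Y : Submodule 𝔽 V) (v : V) (hv : v ∉ H ⊔ Y) :
    (H ⊔ Submodule.span 𝔽 {v}) ⊓ Y = H ⊓ Y := by
  refine le_antisymm ?_ (inf_le_inf_right _ le_sup_left)
  rintro x ⟨hx, hy⟩
  obtain ⟨h, hh, w, hw, rfl⟩ := Submodule.mem_sup.1 hx
  obtain ⟨c, rfl⟩ := Submodule.mem_span_singleton.1 hw
  by_cases hc : c = 0
  · subst hc
    rw [zero_smul, add_zero] at *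
    exact ⟨hh, hy⟩
  · exfalso
    apply hv
    have h1 : c • v ∈ H ⊔ Y := by
      have : c • v = (h + c • v) - h := by abel
      rw [this]
      exact Submodule.sub_mem _ (Submodule.mem_sup_right hy) (Submodule.mem_sup_left hh)
    exact (Submodule.smul_mem_iff _ hc).1 h1

def Adj {k : ℕ} (z U : X 𝔽 V k) : Prop := Module.finrank 𝔽 ↥(z.1 ⊓ U.1) + 1 = k

lemma Adj.symm {k : ℕ} {z U : X 𝔽 V k} (h : Adj z U) : Adj U z := by
  unfold Adj at *; rwa [inf_comm]

lemma Adj.le {k : ℕ} {z U : X 𝔽 V k} (h : Adj z U) (W : Submodule 𝔽 V) :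
    Module.finrank 𝔽 ↥(z.1 ⊓ W) ≤ Module.finrank 𝔽 ↥(z.1 ⊓ U.1 ⊓ W) + 1 := by
  have := finrank_inf_hyper k z.1 (z.1 ⊓ U.1) W z.2 (by unfold Adj at h; omega) inf_le_left
  rwa [inf_comm, inf_comm W] at this

lemma mkAdj {k : ℕ} (U : X 𝔽 V k) (H : Submodule 𝔽 V) (hH : Module.finrank 𝔽 H + 1 = k) (hHU : H ≤ U.1)
    (v : V) (hv : v ∉ U.1) : ∃ z : X 𝔽 V k, z.1 = H ⊔ Submodule.span 𝔽 {v} ∧ Adj z U ∧ z.1 ⊓ U.1 = H := by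
  have h1 : v ∉ H := fun h => hv (hHU h)
  refine ⟨⟨H ⊔ Submodule.span 𝔽 {v}, by rw [finrank_sup_span h1, hH]⟩, rfl, ?_⟩
  have h2 : (H ⊔ Submodule.span 𝔽 {v}) ⊓ U.1 = H := by
    rw [sup_span_inf H U.1 v (by rwa [sup_eq_right.2 hHU]), inf_eq_left.2 hHU]
  exact ⟨by unfold Adj; rw [h2, hH], h2⟩

lemma finrank_inf_add (U W : Submodule 𝔽 V) :
    Module.finrank 𝔽 ↥(U ⊔ W) + Module.finrank 𝔽 ↥(U ⊓ W) = Module.finrank 𝔽 U + Module.finrank 𝔽 W :=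
  Submodule.finrank_sup_add_finrank_inf_eq U W

/-- evaluating `N` at a zero of `g` -/
lemma N_adj {k : ℕ} (g : X 𝔽 V k → ℝ) (U : X 𝔽 V k) (hg : g U = 0) :
    N 𝔽 V k g U = ∑ z, ind (Adj z U) * g z := by
  have e : N 𝔽 V k g U = ∑ z : X 𝔽 V k, (∑ L : X 𝔽 V (k - 1), ind (L.1 ≤ z.1 ⊓ U.1)) * g z := by
    rw [N_apply]
    simp only [Finset.mul_sum, Finset.sum_mul]
    rw [Finset.sum_comm]
    refine Finset.sum_congr rfl fun z _ => Finset.sum_congr rfl fun L _ => ?_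
    rw [← mul_assoc, ind_mul, and_comm, ind_congr le_inf_iff]
  rw [e]
  refine Finset.sum_congr rfl fun z _ => ?_
  by_cases hz : z = U
  · rw [hz, hg, mul_zero, mul_zero]
  congr 1
  have hlt : Module.finrank 𝔽 ↥(z.1 ⊓ U.1) < k := finrank_inf_lt z fun h =>
    hz (Subtype.ext (Submodule.eq_of_le_of_finrank_eq h (by rw [z.2, U.2])))
  by_cases ha : Adj z U
  · rw [cnt_zero, ind_true ha]
    unfold Adj at ha
    rw [show Module.finrank 𝔽 ↥(z.1 ⊓ U.1) = k - 1 by omega, cc_full qq_ge]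
  · rw [ind_false ha]
    refine Finset.sum_eq_zero fun L _ => ind_false (not_le_of_finrank ?_)
    unfold Adj at ha
    rw [L.2]; omega

/-- counting neighbours -/
lemma cnt_adj {k a : ℕ} (U : X 𝔽 V k) (A B : Submodule 𝔽 V) (hA : Module.finrank 𝔽 A = a)
    (hak : a + 1 ≤ k) (hAU : A ≤ U.1) (hUB : U.1 ≤ B) :
    ∑ z : X 𝔽 V k, ind (Adj z U ∧ A ≤ z.1 ∧ z.1 ≤ B)
      = (qq 𝔽 ^ (k - a) - 1) * (qq 𝔽 ^ (Module.finrank 𝔽 B - (k - 1)) - qq 𝔽) / (qq 𝔽 - 1) ^ 2 := by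
  have hq := qq_ge (𝔽 := 𝔽)
  have hq1 : qq 𝔽 - 1 ≠ 0 := by linarith
  obtain ⟨κ, rfl⟩ : ∃ κ, k = κ + 1 := ⟨k - 1, by omega⟩
  have hc1 : ∑ L : X 𝔽 V κ, ind (A ≤ L.1 ∧ L.1 ≤ U.1) = (qq 𝔽 ^ (κ + 1 - a) - 1) / (qq 𝔽 - 1) := by
    rw [cnt_le κ a A U.1 hA (by omega) hAU, U.2, cc_hyper hq κ (κ - a) a (by omega)]
  have hBk : κ + 1 ≤ Module.finrank 𝔽 B := by
    have := Submodule.finrank_mono hUB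
    rwa [U.2] at this
  have hc2 : ∑ z : X 𝔽 V (κ + 1), ∑ L : X 𝔽 V κ, ind ((A ≤ L.1 ∧ L.1 ≤ U.1) ∧ (L.1 ≤ z.1 ∧ z.1 ≤ B))
      = (qq 𝔽 ^ (κ + 1 - a) - 1) / (qq 𝔽 - 1) * ((qq 𝔽 ^ (Module.finrank 𝔽 B - κ) - 1) / (qq 𝔽 - 1)) := by
    rw [Finset.sum_comm, ← hc1, Finset.sum_mul]
    refine Finset.sum_congr rfl fun L _ => ?_
    simp only [← ind_mul (_ ∧ _) (_ ∧ _)]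
    rw [← Finset.mul_sum]
    by_cases hL : A ≤ L.1 ∧ L.1 ≤ U.1
    · rw [cnt_le (κ + 1) κ L.1 B L.2 (by omega) (hL.2.trans hUB), cc_top hq _ _ hBk]
    · rw [ind_false hL, zero_mul, zero_mul]
  have hc3 : ∀ z : X 𝔽 V (κ + 1), z ≠ U →
      ∑ L : X 𝔽 V κ, ind ((A ≤ L.1 ∧ L.1 ≤ U.1) ∧ (L.1 ≤ z.1 ∧ z.1 ≤ B)) = ind (Adj z U ∧ A ≤ z.1 ∧ z.1 ≤ B) := by
    intro z hz
    have hlt : Module.finrank 𝔽 ↥(z.1 ⊓ U.1) < κ + 1 := finrank_inf_lt z fun h =>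
      hz (Subtype.ext (Submodule.eq_of_le_of_finrank_eq h (by rw [z.2, U.2])))
    have key : ∀ L : X 𝔽 V κ, L.1 ≤ U.1 → L.1 ≤ z.1 → z.1 ⊓ U.1 = L.1 := fun L h1 h2 =>
      (Submodule.eq_of_le_of_finrank_le (le_inf h2 h1) (by rw [L.2]; omega)).symm
    by_cases hh : Adj z U ∧ A ≤ z.1 ∧ z.1 ≤ B
    · rw [ind_true hh]
      have hf : Module.finrank 𝔽 ↥(z.1 ⊓ U.1) = κ := by
        have := hh.1
        unfold Adj at this; omega
      rw [Finset.sum_eq_single ⟨z.1 ⊓ U.1, hf⟩, ind_true]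
      · exact ⟨⟨le_inf hh.2.1 hAU, inf_le_right⟩, inf_le_left, hh.2.2⟩
      · intro L _ hL
        refine ind_false fun h => hL (Subtype.ext (key L h.1.2 h.2.1).symm)
      · intro h; exact absurd (Finset.mem_univ _) h
    · rw [ind_false hh]
      refine Finset.sum_eq_zero fun L _ => ind_false fun h => hh ⟨?_, h.1.1.trans h.2.1, h.2.2⟩
      unfold Adj
      rw [key L h.1.2 h.2.1, L.2]
  have hc4 : ∑ L : X 𝔽 V κ, ind ((A ≤ L.1 ∧ L.1 ≤ U.1) ∧ (L.1 ≤ U.1 ∧ U.1 ≤ B))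
      = (qq 𝔽 ^ (κ + 1 - a) - 1) / (qq 𝔽 - 1) := by
    rw [← hc1]
    exact Finset.sum_congr rfl fun L _ => ind_congr ⟨fun h => h.1, fun h => ⟨h, h.2, hUB⟩⟩
  have hc5 : ind (Adj U U ∧ A ≤ U.1 ∧ U.1 ≤ B) = 0 := by
    refine ind_false fun h => ?_
    have := h.1
    unfold Adj at this
    rw [inf_idem, U.2] at this
    omega
  rw [← Finset.add_sum_erase _ _ (Finset.mem_univ U), hc4] at hc2
  rw [← Finset.add_sum_erase _ _ (Finset.mem_univ U), hc5, zero_add,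
    ← Finset.sum_congr rfl fun z hz => hc3 z (Finset.ne_of_mem_erase hz), Nat.add_sub_cancel]
  rw [← eq_sub_iff_add_eq'] at hc2
  rw [hc2]
  field_simp
  ring

end lin

end EKRq

end partF1

section partF2
open Classical Finset

namespace EKRq

set_option linter.unusedSectionVars false

section ext

variable {𝔽 V : Type*} [Field 𝔽] [Fintype 𝔽] [AddCommGroup V] [Module 𝔽 V] [Fintype V]

structure Extr {k : ℕ} (t : ℕ) (F : Finset (X 𝔽 V k)) : Prop where
  ht : 1 ≤ t
  htk : t + 1 ≤ k
  hn : 2 * k ≤ Module.finrank 𝔽 V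
  hF : TInt t F
  hM : chi F ∈ M 𝔽 V k t
  hcard : (F.card : ℝ) = cc (qq 𝔽) (Module.finrank 𝔽 V) 0 t k

variable {k t : ℕ} {F : Finset (X 𝔽 V k)}

lemma Extr.vanish (h : Extr t F) {U : X 𝔽 V k} (hU : U ∈ F) (z : X 𝔽 V k)
    (hz : Module.finrank 𝔽 ↥(z.1 ⊓ U.1) < t) : chi F z = 0 :=
  ind_false fun h1 => absurd (h.hF U hU z h1) (by omega)

lemma Extr.exists_opp (h : Extr t F) {U : X 𝔽 V k} (hU : U ∈ F) :
    ∃ U' ∈ F, Module.finrank 𝔽 ↥(U.1 ⊓ U'.1) = t := by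
  by_contra hc
  push Not at hc
  have := h.htk
  obtain ⟨c, hc1, hf⟩ := M_dec k t (by omega) _ h.hM
  have h1 := transfer k (by omega) h.hn (Finset.range (t + 1))
    (fun j hj => by rw [Finset.mem_range] at hj; omega) c hc1 (fun _ => 1) U (by
      intro z hz
      rw [← hf]
      refine ind_false fun h2 => ?_
      have h3 := hc z h2
      have h4 := h.hF U hU z h2
      rw [inf_comm] at h3
      rw [Finset.card_range] at hz
      omega)
  simp only [one_smul] at h1
  rw [← hf] at h1
  have h2 : chi F U = 1 := ind_true hU
  linarith

lemma Extr.d_mem (h : Extr t F) (T : Submodule 𝔽 V) (hT : Module.finrank 𝔽 T = t) :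
    chi F - star k T ∈ M 𝔽 V k t := Submodule.sub_mem _ h.hM (star_mem_M k t T hT.le)

lemma Extr.d_sum (h : Extr t F) (T : Submodule 𝔽 V) (hT : Module.finrank 𝔽 T = t) :
    ∑ z, (chi F - star k T) z = 0 := by
  have := h.htk
  simp only [Pi.sub_apply, Finset.sum_sub_distrib]
  rw [chi_sum, h.hcard, ← chi_starF, chi_sum, card_starF k t T hT (by omega), sub_self]

lemma Extr.d_vanish (h : Extr t F) {U : X 𝔽 V k} (hU : U ∈ F) {T : Submodule 𝔽 V}
    (hT : Module.finrank 𝔽 T = t) (hTU : T ≤ U.1) (z : X 𝔽 V k)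
    (hz : Module.finrank 𝔽 ↥(z.1 ⊓ U.1) < t) : (chi F - star k T) z = 0 := by
  rw [Pi.sub_apply, h.vanish hU z hz, zero_sub, neg_eq_zero]
  refine ind_false fun h1 => ?_
  have := Submodule.finrank_mono (le_inf h1 hTU)
  omega

lemma Extr.d_self (_h : Extr t F) {U : X 𝔽 V k} (hU : U ∈ F) {T : Submodule 𝔽 V}
    (hTU : T ≤ U.1) : (chi F - star k T) U = 0 := by
  have h1 : chi F U = 1 := ind_true hU
  have h2 : star k T U = 1 := ind_true hTU
  rw [Pi.sub_apply, h1, h2, sub_self]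

lemma Extr.d_N (h : Extr t F) {U : X 𝔽 V k} (hU : U ∈ F) {T : Submodule 𝔽 V}
    (hT : Module.finrank 𝔽 T = t) (hTU : T ≤ U.1) :
    ∑ z, ind (Adj z U) * (chi F - star k T) z = 0 := by
  have := h.htk
  have := h.hn
  rw [← N_adj _ U (h.d_self hU hTU)]
  have hv := h.d_vanish hU hT hTU
  obtain ⟨c, hc, hf⟩ := M_dec_zero k t (by omega) _ (h.d_mem T hT) (h.d_sum T hT)
  have hJ : ∀ j ∈ Finset.Icc 1 t, j ≤ k := fun j hj => by rw [Finset.mem_Icc] at hj; omega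
  rw [hf] at hv ⊢
  rw [N_sum k (by omega) (by omega) _ hJ c hc]
  refine transfer k (by omega) h.hn _ hJ c hc _ U fun z hz => hv z ?_
  rwa [Nat.card_Icc, Nat.add_sub_cancel] at hz

lemma Extr.d_G (h : Extr t F) {U : X 𝔽 V k} (hU : U ∈ F) {T : Submodule 𝔽 V}
    (hT : Module.finrank 𝔽 T = t) (hTU : T ≤ U.1) :
    G 𝔽 V k (chi F - star k T) U = 0 := by
  have := h.htk
  have := h.hn
  have hv := h.d_vanish hU hT hTU
  obtain ⟨c, hc, hf⟩ := M_dec_zero k t (by omega) _ (h.d_mem T hT) (h.d_sum T hT)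
  have hJ : ∀ j ∈ Finset.Icc 1 t, j ≤ k := fun j hj => by rw [Finset.mem_Icc] at hj; omega
  have hg : ∀ j, ∃ γ : ℝ, 1 ≤ j → j ≤ k → ∀ φ ∈ H 𝔽 V j k, G 𝔽 V k φ = γ • φ := by
    intro j
    by_cases hj : 1 ≤ j ∧ j ≤ k
    · obtain ⟨γ, hγ⟩ := G_lift (𝔽 := 𝔽) (V := V) k j hj.1 hj.2
      exact ⟨γ, fun _ _ => hγ⟩
    · exact ⟨0, fun h1 h2 => absurd ⟨h1, h2⟩ hj⟩
  choose γ hγ using hg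
  rw [hf] at hv ⊢
  have e : G 𝔽 V k (∑ j ∈ Finset.Icc 1 t, c j) = ∑ j ∈ Finset.Icc 1 t, γ j • c j := by
    rw [map_sum]
    refine Finset.sum_congr rfl fun j hj => ?_
    rw [Finset.mem_Icc] at hj
    exact hγ j hj.1 (by omega) _ (hc j)
  rw [e]
  refine transfer k (by omega) h.hn _ hJ c hc _ U fun z hz => hv z ?_
  rwa [Nat.card_Icc, Nat.add_sub_cancel] at hz

lemma M_mul (v : V) (f : X 𝔽 V k → ℝ) (hf : f ∈ M 𝔽 V k t) :
    (fun z => ind (v ∈ z.1) * f z) ∈ M 𝔽 V k (t + 1) := by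
  unfold M at hf
  induction hf using Submodule.span_induction with
  | mem f hf =>
    obtain ⟨L, hL, rfl⟩ := hf
    have : (fun z : X 𝔽 V k => ind (v ∈ z.1) * star k L z) = star k (L ⊔ Submodule.span 𝔽 {v}) := by
      funext z
      unfold star
      rw [ind_mul]
      refine ind_congr ?_
      rw [sup_le_iff, Submodule.span_singleton_le_iff_mem, and_comm]
    rw [this]
    refine star_mem_M k _ _ ?_
    by_cases hv : v ∈ L
    · rw [sup_eq_left.2 (by rwa [Submodule.span_singleton_le_iff_mem])]; omega
    · rw [finrank_sup_span hv]; omega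
  | zero =>
    simp only [Pi.zero_apply, mul_zero]
    exact Submodule.zero_mem _
  | add f g _ _ hf hg =>
    have := Submodule.add_mem _ hf hg
    convert this using 1
    funext z
    simp only [Pi.add_apply, mul_add]
  | smul a f _ hf =>
    have := Submodule.smul_mem _ a hf
    convert this using 1
    funext z
    simp only [Pi.smul_apply, smul_eq_mul]
    ring

lemma Extr.e_N (h : Extr t F) {U U' : X 𝔽 V k} (hU : U ∈ F) (hU' : U' ∈ F)
    (hT : Module.finrank 𝔽 ↥(U.1 ⊓ U'.1) = t) :
    ∑ z, ind (Adj z U) * (qq 𝔽 ^ Module.finrank 𝔽 ↥(z.1 ⊓ U'.1) * (chi F - star k (U.1 ⊓ U'.1)) z) = 0 := by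
  have := h.htk
  have := h.hn
  obtain ⟨d, hd⟩ : ∃ d, d = chi F - star k (U.1 ⊓ U'.1) := ⟨_, rfl⟩
  have hv := h.d_vanish hU hT inf_le_left
  have hd0 := h.d_self hU (inf_le_left : U.1 ⊓ U'.1 ≤ _)
  have hdM := h.d_mem _ hT
  have hG := h.d_G hU' hT inf_le_right
  rw [← hd] at hv hd0 hdM hG ⊢
  obtain ⟨e, he⟩ : ∃ e : X 𝔽 V k → ℝ, e = fun z => qq 𝔽 ^ Module.finrank 𝔽 ↥(z.1 ⊓ U'.1) * d z := ⟨_, rfl⟩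
  have he1 : e = ∑ v : V, ind (v ∈ U'.1) • (fun z : X 𝔽 V k => ind (v ∈ z.1) * d z) := by
    rw [he]
    funext z
    rw [Finset.sum_apply, ← sum_mem, Finset.sum_mul]
    refine Finset.sum_congr rfl fun v _ => ?_
    rw [Pi.smul_apply, smul_eq_mul, ← mul_assoc, ind_mul]
    congr 1
    exact ind_congr (by rw [Submodule.mem_inf, and_comm])
  have heM : e ∈ M 𝔽 V k (t + 1) := by
    rw [he1]
    exact Submodule.sum_mem _ fun v _ => Submodule.smul_mem _ _ (M_mul v d hdM)
  have heS : ∑ z, e z = 0 := by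
    rw [← hG, he1, G_apply]
    simp only [Finset.sum_apply, Pi.smul_apply, smul_eq_mul]
    rw [Finset.sum_comm]
    exact Finset.sum_congr rfl fun v _ => by rw [Finset.mul_sum]
  have hev : ∀ z : X 𝔽 V k, Module.finrank 𝔽 ↥(z.1 ⊓ U.1) < t → e z = 0 := fun z hz => by
    rw [he]
    change _ * d z = 0
    rw [hv z hz, mul_zero]
  have he0 : e U = 0 := by
    rw [he]
    change _ * d U = 0
    rw [hd0, mul_zero]
  have goal : N 𝔽 V k e U = 0 := by
    obtain ⟨c, hc, hf⟩ := M_dec_zero k (t + 1) (by omega) _ heM heS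
    have hJ : ∀ j ∈ Finset.Icc 1 (t + 1), j ≤ k := fun j hj => by rw [Finset.mem_Icc] at hj; omega
    rw [hf] at hev he0 ⊢
    have hQ := Q_loc k t (by omega) (by omega) h.hn _ hJ c hc U hev
    have hz : ∑ j ∈ Finset.Icc 1 t, la 𝔽 V k t j * c j U = 0 := by
      refine Finset.sum_eq_zero fun j hj => ?_
      rw [Finset.mem_Icc] at hj
      rw [la, lam_zero qq_ge h.hn (by omega) hj.1 hj.2, zero_mul]
    rw [he0, Finset.sum_Icc_succ_top (by omega), hz, zero_add] at hQ
    have hc0 : c (t + 1) U = 0 := (mul_eq_zero.1 hQ.symm).resolve_left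
      (lam_pos qq_ge h.hn (by omega) (by omega)).ne'
    have hJ' : ∀ j ∈ Finset.Icc 1 t, j ≤ k := fun j hj => by rw [Finset.mem_Icc] at hj; omega
    obtain ⟨P, hP, hl⟩ := exists_poly (qq_ge (𝔽 := 𝔽)) h.hn (Finset.Icc 1 t) hJ' (th 𝔽 V k)
    rw [Nat.card_Icc, Nat.add_sub_cancel] at hP
    have h1 := loc_poly k t _ P hP U hev
    rw [poly_sum k (by omega) (by omega) _ hJ c hc, Finset.sum_Icc_succ_top (by omega), Pi.add_apply,
      Pi.smul_apply, hc0, smul_zero, add_zero] at h1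
    rw [N_sum k (by omega) (by omega) _ hJ c hc, Finset.sum_Icc_succ_top (by omega), Pi.add_apply,
      Pi.smul_apply, hc0, smul_zero, add_zero, ← h1]
    have : ∑ j ∈ Finset.Icc 1 t, th 𝔽 V k j • c j
        = ∑ j ∈ Finset.Icc 1 t, (P.eval (th 𝔽 V k j) * be 𝔽 V k j) • c j :=
      Finset.sum_congr rfl fun j hj => by rw [hl j hj]
    rw [this]
  rw [N_adj e U he0, he] at goal
  exact goal

/-- `T ≤ z` for neighbours at maximal intersection -/
lemma adj_T_le {U U' z : X 𝔽 V k} (hT : Module.finrank 𝔽 ↥(U.1 ⊓ U'.1) = t) (hz : Adj z U)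
    (hz' : t + 1 ≤ Module.finrank 𝔽 ↥(z.1 ⊓ U'.1)) : U.1 ⊓ U'.1 ≤ z.1 := by
  have h1 := hz.le U'.1
  have h2 : z.1 ⊓ U.1 ⊓ U'.1 = U.1 ⊓ U'.1 := by
    refine Submodule.eq_of_le_of_finrank_le (by rw [inf_assoc]; exact inf_le_right) (by omega)
  rw [← h2, inf_assoc]
  exact inf_le_left

lemma adj_le {U U' z : X 𝔽 V k} (hT : Module.finrank 𝔽 ↥(U.1 ⊓ U'.1) = t) (hz : Adj z U) :
    Module.finrank 𝔽 ↥(z.1 ⊓ U'.1) ≤ t + 1 := by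
  have h1 := hz.le U'.1
  have h2 : Module.finrank 𝔽 ↥(z.1 ⊓ U.1 ⊓ U'.1) ≤ Module.finrank 𝔽 ↥(U.1 ⊓ U'.1) :=
    Submodule.finrank_mono (by rw [inf_assoc]; exact inf_le_right)
  omega

lemma Extr.convex (h : Extr t F) {U U' z : X 𝔽 V k} (hU : U ∈ F) (hU' : U' ∈ F)
    (hT : Module.finrank 𝔽 ↥(U.1 ⊓ U'.1) = t) (hz : Adj z U)
    (hz' : t + 1 ≤ Module.finrank 𝔽 ↥(z.1 ⊓ U'.1)) : z ∈ F := by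
  have h1 := h.e_N hU hU' hT
  have h2 := h.d_N hU hT inf_le_left
  obtain ⟨d, hd⟩ : ∃ d, d = chi F - star k (U.1 ⊓ U'.1) := ⟨_, rfl⟩
  rw [← hd] at h1 h2
  have h3 : ∀ y : X 𝔽 V k, ind (Adj y U) * (qq 𝔽 ^ Module.finrank 𝔽 ↥(y.1 ⊓ U'.1) * d y)
      = qq 𝔽 ^ t * (ind (Adj y U) * d y) + (qq 𝔽 ^ (t + 1) - qq 𝔽 ^ t) *
        (ind (Adj y U ∧ t + 1 ≤ Module.finrank 𝔽 ↥(y.1 ⊓ U'.1)) * d y) := by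
    intro y
    by_cases hy : Adj y U
    · rw [← ind_mul, ind_true hy, one_mul, one_mul, one_mul]
      have h4 := adj_le hT hy
      by_cases h5 : t + 1 ≤ Module.finrank 𝔽 ↥(y.1 ⊓ U'.1)
      · rw [ind_true h5, show Module.finrank 𝔽 ↥(y.1 ⊓ U'.1) = t + 1 by omega]; ring
      · rw [ind_false h5]
        by_cases h6 : Module.finrank 𝔽 ↥(y.1 ⊓ U'.1) = t
        · rw [h6]; ring
        · have : d y = 0 := by
            rw [hd]
            exact h.d_vanish hU' hT inf_le_right y (by omega)
          rw [this]; ring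
    · rw [← ind_mul, ind_false hy]; ring
  rw [Finset.sum_congr rfl fun y _ => h3 y, Finset.sum_add_distrib, ← Finset.mul_sum, ← Finset.mul_sum,
    h2, mul_zero, zero_add] at h1
  have h4 := (mul_eq_zero.1 h1).resolve_left (pow_sub_pos qq_ge (Nat.lt_succ_self t)).ne'
  have h5 : ∀ y ∈ (Finset.univ : Finset (X 𝔽 V k)),
      ind (Adj y U ∧ t + 1 ≤ Module.finrank 𝔽 ↥(y.1 ⊓ U'.1)) * d y ≤ 0 := by
    intro y _
    by_cases hy : Adj y U ∧ t + 1 ≤ Module.finrank 𝔽 ↥(y.1 ⊓ U'.1)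
    · have h6 : star k (U.1 ⊓ U'.1) y = 1 := ind_true (adj_T_le hT hy.1 hy.2)
      rw [ind_true hy, one_mul, hd, Pi.sub_apply, h6]
      by_cases h7 : y ∈ F
      · have : chi F y = 1 := ind_true h7
        linarith
      · have : chi F y = 0 := ind_false h7
        linarith
    · rw [ind_false hy, zero_mul]
  have h6 := (Finset.sum_eq_zero_iff_of_nonpos h5).1 h4 z (Finset.mem_univ _)
  have h7 : star k (U.1 ⊓ U'.1) z = 1 := ind_true (adj_T_le hT hz hz')
  rw [ind_true ⟨hz, hz'⟩, one_mul, hd, Pi.sub_apply, h7] at h6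
  by_contra h8
  have : chi F z = 0 := ind_false h8
  linarith

end ext

end EKRq

end partF2

section partF3
open Classical Finset

namespace EKRq

set_option linter.unusedSectionVars false

section str

variable {𝔽 V : Type*} [Field 𝔽] [Fintype 𝔽] [AddCommGroup V] [Module 𝔽 V] [Fintype V]

variable {k t : ℕ} {F : Finset (X 𝔽 V k)}

lemma inf_lt_of_mem {A B : Submodule 𝔽 V} (h : A ≤ B) {x : V} (hx : x ∈ B) (hx' : x ∉ A) :
    Module.finrank 𝔽 A < Module.finrank 𝔽 B :=
  Submodule.finrank_lt_finrank_of_lt (lt_of_le_of_ne h fun e => hx' (e ▸ hx))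

lemma adj_eq {z U : X 𝔽 V k} (hz : Adj z U) {v : V} (hv : v ∈ z.1) (hvU : v ∉ U.1) :
    z.1 = z.1 ⊓ U.1 ⊔ Submodule.span 𝔽 {v} := by
  refine (Submodule.eq_of_le_of_finrank_le
    (sup_le inf_le_left (by rwa [Submodule.span_singleton_le_iff_mem])) ?_).symm
  have h1 : v ∉ z.1 ⊓ U.1 := fun h => hvU h.2
  rw [finrank_sup_span h1, z.2]
  unfold Adj at hz
  omega

/-- `z ∈ F` adjacent to `U` not containing `T` -/
lemma Extr.fact1 (h : Extr t F) {U U' z : X 𝔽 V k} (hU' : U' ∈ F)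
    (hT : Module.finrank 𝔽 ↥(U.1 ⊓ U'.1) = t) (hz : Adj z U) (hzF : z ∈ F)
    (hTz : ¬ U.1 ⊓ U'.1 ≤ z.1) :
    (∃ v ∈ z.1 ⊓ U'.1, v ∉ U.1) ∧ z.1 ≤ U.1 ⊔ U'.1 ∧ Module.finrank 𝔽 ↥(z.1 ⊓ U'.1) ≤ t := by
  have h1 := h.hF U' hU' z hzF
  have h2 := hz.le U'.1
  have h3 : Module.finrank 𝔽 ↥(z.1 ⊓ U.1 ⊓ U'.1) < t := by
    rw [← hT]
    refine Submodule.finrank_lt_finrank_of_lt (lt_of_le_of_ne (by rw [inf_assoc]; exact inf_le_right) ?_)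
    intro e
    apply hTz
    rw [← e, inf_assoc]
    exact inf_le_left
  have h4 : ∃ v ∈ z.1 ⊓ U'.1, v ∉ U.1 := by
    by_contra hc
    push Not at hc
    have : z.1 ⊓ U'.1 ≤ z.1 ⊓ U.1 ⊓ U'.1 := fun v hv => ⟨⟨hv.1, hc v hv⟩, hv.2⟩
    have := Submodule.finrank_mono this
    omega
  refine ⟨h4, ?_, by omega⟩
  obtain ⟨v, hv, hvU⟩ := h4
  rw [adj_eq hz hv.1 hvU]
  refine sup_le (inf_le_right.trans le_sup_left) ?_
  rw [Submodule.span_singleton_le_iff_mem]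
  exact Submodule.mem_sup_right hv.2

lemma Extr.fact2 (h : Extr t F) {U U' z1 z2 : X 𝔽 V k} (hU' : U' ∈ F)
    (hT : Module.finrank 𝔽 ↥(U.1 ⊓ U'.1) = t) (hz1 : Adj z1 U) (hz1F : z1 ∈ F)
    (hz2 : Adj z2 U) (hz2F : z2 ∈ F) (hTz1 : U.1 ⊓ U'.1 ≤ z1.1) (hz1S : ¬ z1.1 ≤ U.1 ⊔ U'.1)
    (hTz2 : ¬ U.1 ⊓ U'.1 ≤ z2.1) : False := by
  obtain ⟨v, hv, hvS⟩ := SetLike.not_le_iff_exists.1 hz1S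
  obtain ⟨⟨w, hw, hwU⟩, hz2S, hle⟩ := h.fact1 hU' hT hz2 hz2F hTz2
  have hvU : v ∉ U.1 := fun h => hvS (Submodule.mem_sup_left h)
  have hvU' : v ∉ U'.1 := fun h => hvS (Submodule.mem_sup_right h)
  have hwT : w ∉ U.1 ⊓ U'.1 := fun h => hwU h.1
  -- intersection of z1 with U'
  have e1 : z1.1 ⊓ U'.1 = U.1 ⊓ U'.1 := by
    have h1 : v ∉ z1.1 ⊓ U.1 ⊔ U'.1 := fun h' =>
      hvS ((sup_le_sup_right (inf_le_right : z1.1 ⊓ U.1 ≤ U.1) U'.1) h')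
    rw [adj_eq hz1 hv hvU, sup_span_inf _ _ _ h1]
    rw [inf_assoc]
    exact inf_eq_right.2 hTz1
  obtain ⟨f, hf, hfT⟩ := exists_dual (U.1 ⊓ U'.1) w hwT
  have hH := hyper_finrank U'.1 f w hw.2 hf
  rw [U'.2] at hH
  obtain ⟨y, hy, hyA, hyU'⟩ := mkAdj U' _ hH inf_le_left v hvU'
  have hyF : y ∈ F := by
    refine h.convex hU' hz1F (by rw [inf_comm, e1, hT]) hyA ?_
    have hvT : v ∉ U.1 ⊓ U'.1 := fun h' => hvU h'.1
    rw [← hT, ← finrank_sup_span hvT]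
    refine Submodule.finrank_mono (sup_le (le_inf ?_ hTz1) ?_)
    · rw [hy]
      exact (le_inf inf_le_right hfT).trans le_sup_left
    · rw [Submodule.span_singleton_le_iff_mem]
      exact ⟨by rw [hy]; exact Submodule.mem_sup_right (Submodule.mem_span_singleton_self v), hv⟩
  have h1 := h.hF z2 hz2F y hyF
  rw [hy, sup_span_inf] at h1
  · have h2 : Module.finrank 𝔽 ↥(U'.1 ⊓ LinearMap.ker f ⊓ z2.1) < Module.finrank 𝔽 ↥(z2.1 ⊓ U'.1) :=
      inf_lt_of_mem (le_inf inf_le_right (inf_le_left.trans inf_le_left)) hw (fun h' => hf h'.1.2)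
    omega
  · intro h'
    exact hvS ((sup_le (inf_le_left.trans le_sup_right) hz2S) h')

lemma eq_of_count {P Q : X 𝔽 V k → Prop} (hPQ : ∀ z, P z → Q z)
    (hs : ∑ z, ind (Q z) ≤ ∑ z, ind (P z)) (z : X 𝔽 V k) : Q z → P z := by
  have h1 : ∀ y ∈ (Finset.univ : Finset (X 𝔽 V k)), ind (P y) ≤ ind (Q y) := by
    intro y _
    by_cases hp : P y
    · rw [ind_true hp, ind_true (hPQ y hp)]
    · rw [ind_false hp]; exact ind_nonneg _
  have h2 := (Finset.sum_eq_sum_iff_of_le h1).1 (le_antisymm (Finset.sum_le_sum h1) hs) z (Finset.mem_univ _)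
  intro hq
  by_contra hp
  rw [ind_true hq, ind_false hp] at h2
  norm_num at h2

lemma Extr.dich (h : Extr t F) {U U' : X 𝔽 V k} (hU : U ∈ F) (hU' : U' ∈ F)
    (hT : Module.finrank 𝔽 ↥(U.1 ⊓ U'.1) = t) :
    (∀ z, Adj z U → (z ∈ F ↔ U.1 ⊓ U'.1 ≤ z.1)) ∨
    (Module.finrank 𝔽 V = 2 * k ∧ ∀ z, Adj z U → (z ∈ F ↔ z.1 ≤ U.1 ⊔ U'.1)) := by
  have hn := h.hn
  have htk := h.htk
  have ht := h.ht
  have hS := finrank_inf_add U.1 U'.1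
  rw [U.2, U'.2, hT] at hS
  have hq := qq_ge (𝔽 := 𝔽)
  have c0 : ∑ z, ind (Adj z U ∧ z ∈ F) = ∑ z, ind (Adj z U ∧ U.1 ⊓ U'.1 ≤ z.1) := by
    have h1 := h.d_N hU hT inf_le_left
    simp only [Pi.sub_apply, mul_sub, Finset.sum_sub_distrib, sub_eq_zero] at h1
    rw [Finset.sum_congr rfl fun z _ => (ind_mul _ _).symm,
      Finset.sum_congr rfl fun z _ => (ind_mul (Adj z U) (U.1 ⊓ U'.1 ≤ z.1)).symm]
    exact h1
  by_cases hA : ∀ z, Adj z U → z ∈ F → U.1 ⊓ U'.1 ≤ z.1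
  · left
    intro z hz
    refine ⟨hA z hz, fun hz' => ?_⟩
    exact (eq_of_count (P := fun z => Adj z U ∧ z ∈ F) (Q := fun z => Adj z U ∧ U.1 ⊓ U'.1 ≤ z.1)
      (fun z hz => ⟨hz.1, hA z hz.1 hz.2⟩) c0.ge z ⟨hz, hz'⟩).2
  · right
    push Not at hA
    obtain ⟨z2, hz2, hz2F, hTz2⟩ := hA
    have hB : ∀ z, Adj z U → z ∈ F → z.1 ≤ U.1 ⊔ U'.1 := by
      intro z hz hzF
      by_cases hTz : U.1 ⊓ U'.1 ≤ z.1
      · by_contra hc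
        exact h.fact2 hU' hT hz hzF hz2 hz2F hTz hc hTz2
      · exact (h.fact1 hU' hT hz hzF hTz).2.1
    have c1 := cnt_adj U (U.1 ⊓ U'.1) ⊤ hT htk inf_le_left le_top
    have c2 := cnt_adj U ⊥ (U.1 ⊔ U'.1) (finrank_bot 𝔽 V) (by omega) bot_le le_sup_left
    simp only [le_top, and_true, bot_le, true_and] at c1 c2
    rw [finrank_top] at c1
    have c3 : ∑ z, ind (Adj z U ∧ z ∈ F) ≤ ∑ z, ind (Adj z U ∧ z.1 ≤ U.1 ⊔ U'.1) := by
      refine Finset.sum_le_sum fun z _ => ?_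
      by_cases hp : Adj z U ∧ z ∈ F
      · rw [ind_true hp, ind_true ⟨hp.1, hB z hp.1 hp.2⟩]
      · rw [ind_false hp]; exact ind_nonneg _
    have hq1 : 0 < qq 𝔽 - 1 := by linarith
    have hkt : 0 < qq 𝔽 ^ (k - t) - 1 := by
      have := pow_sub_pos hq (show 0 < k - t by omega)
      rwa [pow_zero] at this
    have e1 : qq 𝔽 ^ (Module.finrank 𝔽 V - (k - 1)) = qq 𝔽 ^ (Module.finrank 𝔽 V - k) * qq 𝔽 := by
      rw [← pow_succ]; congr 1; omega
    have e2 : qq 𝔽 ^ (Module.finrank 𝔽 ↥(U.1 ⊔ U'.1) - (k - 1)) = qq 𝔽 ^ (k - t) * qq 𝔽 := by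
      rw [← pow_succ]; congr 1; omega
    rw [e1] at c1
    rw [e2, Nat.sub_zero] at c2
    have hnk : Module.finrank 𝔽 V = 2 * k := by
      by_contra hne
      have h1 : (qq 𝔽 ^ (k - t) - 1) * (qq 𝔽 ^ (Module.finrank 𝔽 V - k) * qq 𝔽 - qq 𝔽)
          ≤ (qq 𝔽 ^ k - 1) * (qq 𝔽 ^ (k - t) * qq 𝔽 - qq 𝔽) := by
        rw [c0, c1, c2, div_le_div_iff_of_pos_right (by positivity)] at c3
        exact c3
      have h2 := pow_sub_pos hq (show k < Module.finrank 𝔽 V - k by omega)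
      have h3 : (qq 𝔽 ^ (k - t) - 1) * (qq 𝔽) * (qq 𝔽 ^ (Module.finrank 𝔽 V - k) - qq 𝔽 ^ k) ≤ 0 := by
        nlinarith
      have : 0 < (qq 𝔽 ^ (k - t) - 1) * (qq 𝔽) * (qq 𝔽 ^ (Module.finrank 𝔽 V - k) - qq 𝔽 ^ k) := by
        have : 0 < qq 𝔽 := by linarith
        positivity
      linarith
    refine ⟨hnk, fun z hz => ⟨hB z hz, fun hz' => ?_⟩⟩
    refine (eq_of_count (P := fun z => Adj z U ∧ z ∈ F) (Q := fun z => Adj z U ∧ z.1 ≤ U.1 ⊔ U'.1)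
      (fun z hz => ⟨hz.1, hB z hz.1 hz.2⟩) (le_of_eq ?_) z ⟨hz, hz'⟩).2
    rw [c0, c1, c2, hnk, show 2 * k - k = k by omega]
    ring

end str

end EKRq

end partF3

section partF4
open Classical Finset

namespace EKRq

set_option linter.unusedSectionVars false

section str2

variable {𝔽 V : Type*} [Field 𝔽] [Fintype 𝔽] [AddCommGroup V] [Module 𝔽 V] [Fintype V]

variable {k t : ℕ} {F : Finset (X 𝔽 V k)}

lemma Extr.caseA (h : Extr t F) {U' Y : X 𝔽 V k} (hU' : U' ∈ F) (hY : Y ∈ F) (T : Submodule 𝔽 V)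
    (hTt : Module.finrank 𝔽 T = t) (d : ℕ) :
    ∀ U ∈ F, U.1 ⊓ U'.1 = T → (∀ z, Adj z U → (z ∈ F ↔ T ≤ z.1)) →
      Module.finrank 𝔽 ↥(U.1 ⊓ Y.1) = d → T ≤ Y.1 := by
  have hn := h.hn
  have htk := h.htk
  have ht := h.ht
  induction d using Nat.strong_induction_on with
  | _ d ih =>
    intro U hU hUT hprop hd
    by_contra hTY
    have htd := h.hF Y hY U hU
    have hx : ∃ x ∈ U.1 ⊓ Y.1, x ∉ T := by
      by_contra hc
      push Not at hc
      have h1 : U.1 ⊓ Y.1 ≤ T := hc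
      have h2 := Submodule.eq_of_le_of_finrank_le h1 (by omega)
      exact hTY (h2 ▸ inf_le_right)
    obtain ⟨x, hx, hxT⟩ := hx
    obtain ⟨f, hf, hfT⟩ := exists_dual T x hxT
    have hH := hyper_finrank U.1 f x hx.1 hf
    rw [U.2] at hH
    have hTU : T ≤ U.1 := hUT ▸ inf_le_left
    obtain ⟨H, hHdef⟩ : ∃ H, H = U.1 ⊓ LinearMap.ker f := ⟨_, rfl⟩
    rw [← hHdef] at hH
    have hHU : H ≤ U.1 := hHdef ▸ inf_le_left
    have hTH : T ≤ H := hHdef ▸ le_inf hTU hfT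
    have hxH : x ∉ H := fun h' => by rw [hHdef] at h'; exact hf h'.2
    have hS := finrank_inf_add U.1 U'.1
    rw [U.2, U'.2, hUT, hTt] at hS
    have hS2 := finrank_inf_add U.1 Y.1
    rw [U.2, Y.2] at hS2
    obtain ⟨v, -, hv1, hv2⟩ := exists_avoid ⊤ (U.1 ⊔ Y.1) (U.1 ⊔ U'.1)
      (fun h' => by have := Submodule.finrank_mono h'; rw [finrank_top] at this; omega)
      (fun h' => by have := Submodule.finrank_mono h'; rw [finrank_top] at this; omega)
    have hvU : v ∉ U.1 := fun h' => hv2 (Submodule.mem_sup_left h')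
    obtain ⟨z, hz, hzA, hzU⟩ := mkAdj U H hH hHU v hvU
    have hvz : v ∈ z.1 := by rw [hz]; exact Submodule.mem_sup_right (Submodule.mem_span_singleton_self v)
    have hHz : H ≤ z.1 := hz ▸ le_sup_left
    have hzF : z ∈ F := (hprop z hzA).2 (hTH.trans hHz)
    have hzU' : z.1 ⊓ U'.1 = T := by
      have h1 : v ∉ H ⊔ U'.1 := fun h' => hv2 ((sup_le_sup_right hHU U'.1) h')
      rw [hz, sup_span_inf _ _ _ h1]
      refine le_antisymm (hUT ▸ inf_le_inf_right _ hHU) (le_inf hTH (hUT ▸ inf_le_right))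
    have hzY : Module.finrank 𝔽 ↥(z.1 ⊓ Y.1) < d := by
      have h1 : v ∉ H ⊔ Y.1 := fun h' => hv1 ((sup_le_sup_right hHU Y.1) h')
      rw [hz, sup_span_inf _ _ _ h1, ← hd]
      exact inf_lt_of_mem (inf_le_inf_right _ hHU) hx (fun h' => hxH h'.1)
    refine hTY (ih _ hzY z hzF hzU' ?_ rfl)
    rcases h.dich hzF hU' (by rw [hzU', hTt]) with h1 | ⟨-, h1⟩
    · rw [hzU'] at h1; exact h1
    · exfalso
      have h2 : U.1 ≤ z.1 ⊔ U'.1 := (h1 U hzA.symm).1 hU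
      have h3 := finrank_inf_add z.1 U'.1
      rw [z.2, U'.2, hzU', hTt] at h3
      have h4 : U.1 ⊔ U'.1 = z.1 ⊔ U'.1 :=
        Submodule.eq_of_le_of_finrank_le (sup_le h2 le_sup_right) (by omega)
      exact hv2 (h4 ▸ Submodule.mem_sup_left hvz)

lemma Extr.caseB (h : Extr t F) {U' Y : X 𝔽 V k} (hU' : U' ∈ F) (hY : Y ∈ F) (S : Submodule 𝔽 V)
    (d : ℕ) :
    ∀ U ∈ F, U.1 ⊔ U'.1 = S → Module.finrank 𝔽 ↥(U.1 ⊓ U'.1) = t →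
      (∀ z, Adj z U → (z ∈ F ↔ z.1 ≤ S)) →
      Module.finrank 𝔽 ↥(U.1 ⊓ Y.1) = d → Y.1 ≤ S := by
  have hn := h.hn
  have htk := h.htk
  have ht := h.ht
  induction d using Nat.strong_induction_on with
  | _ d ih =>
    intro U hU hUS hUt hprop hd
    by_contra hYS
    have htd := h.hF Y hY U hU
    have hS := finrank_inf_add U.1 U'.1
    rw [U.2, U'.2, hUt, hUS] at hS
    have hUS' : U.1 ≤ S := hUS ▸ le_sup_left
    have hU'S : U'.1 ≤ S := hUS ▸ le_sup_right
    obtain ⟨x, hx, hx0⟩ := (U.1 ⊓ U'.1).exists_mem_ne_zero_of_ne_bot (fun e => by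
      rw [e, finrank_bot] at hUt; omega)
    obtain ⟨y, hy, hy0⟩ := (U.1 ⊓ Y.1).exists_mem_ne_zero_of_ne_bot (fun e => by
      rw [e, finrank_bot] at htd; omega)
    obtain ⟨f, hfx, hfy⟩ := exists_dual_two (𝔽 := 𝔽) x y hx0 hy0
    have hH := hyper_finrank U.1 f x hx.1 hfx
    rw [U.2] at hH
    obtain ⟨H, hHdef⟩ : ∃ H, H = U.1 ⊓ LinearMap.ker f := ⟨_, rfl⟩
    rw [← hHdef] at hH
    have hHU : H ≤ U.1 := hHdef ▸ inf_le_left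
    have hxH : x ∉ H := fun h' => by rw [hHdef] at h'; exact hfx h'.2
    have hyH : y ∉ H := fun h' => by rw [hHdef] at h'; exact hfy h'.2
    have hHY : Module.finrank 𝔽 ↥(H ⊓ Y.1) < Module.finrank 𝔽 ↥(U.1 ⊓ Y.1) :=
      inf_lt_of_mem (inf_le_inf_right _ hHU) hy (fun h' => hyH h'.1)
    have hHU2 : H ⊔ Submodule.span 𝔽 {x} = U.1 := by
      refine Submodule.eq_of_le_of_finrank_le
        (sup_le hHU (by rw [Submodule.span_singleton_le_iff_mem]; exact hx.1)) ?_
      rw [finrank_sup_span hxH, U.2, hH]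
    -- S is not contained in H ⊔ Y
    have hSHY : ¬ S ≤ H ⊔ Y.1 := by
      intro h'
      have h1 := finrank_inf_add U.1 Y.1
      rw [U.2, Y.2] at h1
      have h2 : S = U.1 ⊔ Y.1 :=
        Submodule.eq_of_le_of_finrank_le (h'.trans (sup_le_sup_right hHU _)) (by omega)
      exact hYS (h2 ▸ le_sup_right)
    have hSU : ¬ S ≤ U.1 := fun h' => by
      have := Submodule.finrank_mono h'
      rw [U.2] at this; omega
    obtain ⟨v, hvS, hv1, hvU⟩ := exists_avoid S (H ⊔ Y.1) U.1 hSHY hSU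
    obtain ⟨z, hz, hzA, hzU⟩ := mkAdj U H hH hHU v hvU
    have hvz : v ∈ z.1 := by rw [hz]; exact Submodule.mem_sup_right (Submodule.mem_span_singleton_self v)
    have hHz : H ≤ z.1 := hz ▸ le_sup_left
    have hzS : z.1 ≤ S := by
      rw [hz]
      exact sup_le (hHU.trans hUS') (by rwa [Submodule.span_singleton_le_iff_mem])
    have hzF : z ∈ F := (hprop z hzA).2 hzS
    have hzU' : z.1 ⊔ U'.1 = S := by
      refine le_antisymm (sup_le hzS hU'S) ?_
      rw [← hUS]
      refine sup_le ?_ le_sup_right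
      rw [← hHU2]
      refine sup_le (hHz.trans le_sup_left) ?_
      rw [Submodule.span_singleton_le_iff_mem]
      exact Submodule.mem_sup_right hx.2
    have hzt : Module.finrank 𝔽 ↥(z.1 ⊓ U'.1) = t := by
      have := finrank_inf_add z.1 U'.1
      rw [z.2, U'.2, hzU'] at this
      omega
    have hzY : Module.finrank 𝔽 ↥(z.1 ⊓ Y.1) < d := by
      rw [hz, sup_span_inf _ _ _ hv1, ← hd]
      exact hHY
    refine hYS (ih _ hzY z hzF hzU' hzt ?_ rfl)
    rcases h.dich hzF hU' hzt with h1 | ⟨-, h1⟩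
    · exfalso
      have h2 : z.1 ⊓ U'.1 ≤ U.1 := (h1 U hzA.symm).1 hU
      have h3 : z.1 ⊓ U'.1 = U.1 ⊓ U'.1 :=
        Submodule.eq_of_le_of_finrank_le (le_inf h2 inf_le_right) (by omega)
      rw [← h3] at hx
      exact hxH (hzU ▸ ⟨hx.1, h2 hx⟩)
    · rw [hzU'] at h1; exact h1

/-- structure of extremal families -/
lemma Extr.structure (h : Extr t F) (hne : F.Nonempty) :
    (∃ T : Submodule 𝔽 V, Module.finrank 𝔽 T = t ∧ ∀ z : X 𝔽 V k, z ∈ F ↔ T ≤ z.1) ∨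
    (Module.finrank 𝔽 V = 2 * k ∧ ∃ S : Submodule 𝔽 V, Module.finrank 𝔽 S = 2 * k - t ∧
      ∀ z : X 𝔽 V k, z ∈ F ↔ z.1 ≤ S) := by
  have hn := h.hn
  have htk := h.htk
  have ht := h.ht
  obtain ⟨U, hU⟩ := hne
  obtain ⟨U', hU', hT⟩ := h.exists_opp hU
  have hS := finrank_inf_add U.1 U'.1
  rw [U.2, U'.2, hT] at hS
  rcases h.dich hU hU' hT with h1 | ⟨hnk, h1⟩
  · left
    refine ⟨U.1 ⊓ U'.1, hT, ?_⟩
    have h2 : F ⊆ starF k (U.1 ⊓ U'.1) := fun Y hY => by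
      rw [mem_starF]
      exact h.caseA hU' hY _ hT _ U hU rfl h1 rfl
    have h3 : F = starF k (U.1 ⊓ U'.1) := by
      refine Finset.eq_of_subset_of_card_le h2 ?_
      have := card_starF k t (U.1 ⊓ U'.1) hT (by omega)
      rw [← h.hcard] at this
      exact_mod_cast this.le
    intro z
    conv_lhs => rw [h3]
    rw [mem_starF]
  · right
    refine ⟨hnk, U.1 ⊔ U'.1, by omega, ?_⟩
    have h2 : F ⊆ Finset.univ.filter (fun z : X 𝔽 V k => z.1 ≤ U.1 ⊔ U'.1) := fun Y hY => by
      rw [Finset.mem_filter]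
      exact ⟨Finset.mem_univ _, h.caseB hU' hY _ _ U hU rfl hT h1 rfl⟩
    have h3 : F = Finset.univ.filter (fun z : X 𝔽 V k => z.1 ≤ U.1 ⊔ U'.1) := by
      refine Finset.eq_of_subset_of_card_le h2 ?_
      have := (ekr_bound k t (by omega) (by omega) hn
        (Finset.univ.filter (fun z : X 𝔽 V k => z.1 ≤ U.1 ⊔ U'.1)) (by
          intro y hy z hz
          rw [Finset.mem_filter] at hy hz
          have h5 := finrank_inf_add z.1 y.1
          rw [y.2, z.2] at h5
          have h6 := Submodule.finrank_mono (sup_le hz.2 hy.2)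
          omega)).1
      rw [← h.hcard] at this
      exact_mod_cast this
    intro z
    conv_lhs => rw [h3]
    simp

end str2

end EKRq

end partF4

section partG
open Classical Finset

namespace EKRq

set_option linter.unusedSectionVars false

section fin

variable {𝔽 V : Type*} [Field 𝔽] [Fintype 𝔽] [AddCommGroup V] [Module 𝔽 V] [Fintype V]

variable {k t : ℕ} {F : Finset (X 𝔽 V k)}

theorem main_X (htk : t ≤ k) (hn : 2 * k ≤ Module.finrank 𝔽 V) (hF : TInt t F) :
    (F.card : ℝ) ≤ cc (qq 𝔽) (Module.finrank 𝔽 V) 0 t k ∧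
    ((F.card : ℝ) = cc (qq 𝔽) (Module.finrank 𝔽 V) 0 t k →
    (∃ T : Submodule 𝔽 V, Module.finrank 𝔽 T = t ∧ ∀ z : X 𝔽 V k, z ∈ F ↔ T ≤ z.1) ∨
    (Module.finrank 𝔽 V = 2 * k ∧ ∃ S : Submodule 𝔽 V, Module.finrank 𝔽 S = 2 * k - t ∧
      ∀ z : X 𝔽 V k, z ∈ F ↔ z.1 ≤ S)) := by
  have star_case : ∀ T : Submodule 𝔽 V, Module.finrank 𝔽 T = t → (∀ z ∈ F, T ≤ z.1) →
      (F.card : ℝ) = cc (qq 𝔽) (Module.finrank 𝔽 V) 0 t k → ∀ z : X 𝔽 V k, z ∈ F ↔ T ≤ z.1 := by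
    intro T hT h1 hc z
    have h3 : F = starF k T := by
      refine Finset.eq_of_subset_of_card_le (fun z hz => mem_starF.2 (h1 z hz)) ?_
      have := card_starF k t T hT htk
      rw [← hc] at this
      exact_mod_cast this.le
    conv_lhs => rw [h3]
    rw [mem_starF]
  by_cases htk' : t = k
  · have h1 : F.card ≤ 1 := by
      rw [Finset.card_le_one]
      intro a ha b hb
      have h2 := hF b hb a ha
      have h3 : a.1 ⊓ b.1 = a.1 := Submodule.eq_of_le_of_finrank_le inf_le_left (by rw [a.2]; omega)
      have h4 : a.1 ⊓ b.1 = b.1 := Submodule.eq_of_le_of_finrank_le inf_le_right (by rw [b.2]; omega)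
      exact Subtype.ext (h3.symm.trans h4)
    have hcc : cc (qq 𝔽) (Module.finrank 𝔽 V) 0 t k = 1 := by rw [htk', cc_self]
    refine ⟨by rw [hcc]; exact_mod_cast h1, fun hc => Or.inl ?_⟩
    have hc' := hc
    rw [hcc] at hc'
    obtain ⟨U, hU⟩ := Finset.card_eq_one.1 (by exact_mod_cast hc' : F.card = 1)
    refine ⟨U.1, by rw [U.2, htk'], star_case U.1 (by rw [U.2, htk']) ?_ hc⟩
    intro z hz
    rw [hU, Finset.mem_singleton] at hz
    rw [hz]
  · have hb := ekr_bound k t (by omega) htk hn F hF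
    refine ⟨hb.1, fun hc => ?_⟩
    by_cases ht : t = 0
    · left
      exact ⟨⊥, by rw [finrank_bot, ht], star_case ⊥ (by rw [finrank_bot, ht]) (fun z _ => bot_le) hc⟩
    · have hE : Extr t F := ⟨by omega, by omega, hn, hF, hb.2 hc, hc⟩
      refine hE.structure (Finset.card_pos.1 ?_)
      have h1 : 0 < cc (qq 𝔽) (Module.finrank 𝔽 V) 0 t k := cc_pos qq_ge (by omega)
      rw [← hc] at h1
      exact_mod_cast h1

end fin

section gb

noncomputable def fac (q : ℝ) (m : ℕ) : ℝ := ∏ i ∈ Finset.range m, (q ^ (i + 1) - 1)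

lemma one_pow_pos {q : ℝ} (hq : 2 ≤ q) {m : ℕ} (h : 0 < m) : 0 < q ^ m - 1 := by
  have := pow_sub_pos hq h
  rwa [pow_zero] at this

lemma fac_pos {q : ℝ} (hq : 2 ≤ q) (m : ℕ) : 0 < fac q m :=
  Finset.prod_pos fun i _ => one_pow_pos hq (Nat.succ_pos i)

lemma prod_fac {q : ℝ} (m r : ℕ) (h : r ≤ m) :
    (∏ i ∈ Finset.range r, (q ^ (m - i) - 1)) * fac q (m - r) = fac q m := by
  induction r with
  | zero => simp
  | succ r ih =>
    rw [← ih (by omega), Finset.prod_range_succ, mul_assoc]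
    congr 1
    obtain ⟨s, hs⟩ : ∃ s, m - r = s + 1 := ⟨m - r - 1, by omega⟩
    rw [hs, show m - (r + 1) = s by omega]
    unfold fac
    rw [Finset.prod_range_succ, mul_comm]

lemma prod_fac_self {q : ℝ} (r : ℕ) : ∏ i ∈ Finset.range r, (q ^ (r - i) - 1) = fac q r := by
  have := prod_fac (q := q) r r le_rfl
  rwa [Nat.sub_self, fac, Finset.prod_range_zero, mul_one] at this

lemma cc_fac {q : ℝ} (hq : 2 ≤ q) {n t k : ℕ} (htk : t ≤ k) (hn : k ≤ n) :
    cc q n 0 t k = fac q (n - t) / (fac q (k - t) * fac q (n - k)) := by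
  have h1 : cc q n 0 t k = (∏ i ∈ Finset.range (k - t), (q ^ (n - t - i) - 1)) / fac q (k - t) := by
    rw [← prod_fac_self, ← Finset.prod_div_distrib]
    unfold cc
    rw [Finset.prod_Ico_eq_prod_range]
    refine Finset.prod_congr rfl fun i hi => ?_
    rw [Finset.mem_range] at hi
    obtain ⟨a, ha⟩ : ∃ a, n - t - i = a := ⟨_, rfl⟩
    obtain ⟨b, hb⟩ : ∃ b, k - t - i = b := ⟨_, rfl⟩
    rw [ha, hb, zero_add, show n = (t + i) + a by omega, show k = (t + i) + b by omega,
      pow_add q (t + i) a, pow_add q (t + i) b]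
    have hp : q ^ (t + i) ≠ 0 := pow_ne_zero _ (by linarith)
    rw [show q ^ (t + i) * q ^ a - q ^ (t + i) = q ^ (t + i) * (q ^ a - 1) by ring,
      show q ^ (t + i) * q ^ b - q ^ (t + i) = q ^ (t + i) * (q ^ b - 1) by ring,
      mul_div_mul_left _ _ hp]
  have h2 := prod_fac (q := q) (n - t) (k - t) (by omega)
  rw [show n - t - (k - t) = n - k by omega] at h2
  have p1 := (fac_pos hq (k - t)).ne'
  have p2 := (fac_pos hq (n - k)).ne'
  rw [h1, ← h2]
  field_simp

lemma cc_dual {q : ℝ} (hq : 2 ≤ q) {t k : ℕ} (htk : t ≤ k) :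
    cc q (2 * k - t) 0 0 k = cc q (2 * k) 0 t k := by
  rw [cc_fac hq (by omega) (by omega), cc_fac hq htk (by omega), Nat.sub_zero, Nat.sub_zero,
    show 2 * k - t - k = k - t by omega, show 2 * k - k = k by omega, mul_comm (fac q k)]

lemma gaussBinom_eq (q n t k C : ℕ) (hq : 2 ≤ q) (htk : t ≤ k) (hn : k ≤ n)
    (hC : (C : ℝ) = cc q n 0 t k) : gaussBinom q (n - t) (k - t) = C := by
  have hq' : (2 : ℝ) ≤ q := by exact_mod_cast hq
  have hc : ∀ m r : ℕ, ((∏ i ∈ Finset.range r, (q ^ (m - i) - 1) : ℕ) : ℝ)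
      = ∏ i ∈ Finset.range r, ((q : ℝ) ^ (m - i) - 1) := by
    intro m r
    rw [Nat.cast_prod]
    refine Finset.prod_congr rfl fun i _ => ?_
    rw [Nat.cast_sub (Nat.one_le_pow _ _ (by omega))]
    push_cast; rfl
  have h2 := prod_fac (q := (q : ℝ)) (n - t) (k - t) (by omega)
  rw [show n - t - (k - t) = n - k by omega] at h2
  have p1 := fac_pos hq' (k - t)
  have p2 := fac_pos hq' (n - k)
  rw [cc_fac hq' htk hn, ← h2, mul_div_mul_right _ _ p2.ne', eq_div_iff p1.ne', ← prod_fac_self,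
    ← hc, ← hc] at hC
  have hC' : C * (∏ i ∈ Finset.range (k - t), (q ^ (k - t - i) - 1))
      = ∏ i ∈ Finset.range (k - t), (q ^ (n - t - i) - 1) := by exact_mod_cast hC
  unfold gaussBinom
  rw [← hC']
  refine Nat.mul_div_cancel _ ?_
  have h3 := hc (k - t) (k - t)
  rw [prod_fac_self] at h3
  rw [← h3] at p1
  exact_mod_cast p1

end gb

section final

theorem main_aux {𝔽 : Type*} [Field 𝔽] [Fintype 𝔽] (q n k t : ℕ)
    (hq : Fintype.card 𝔽 = q) (htk : t ≤ k) (hn : 2 * k ≤ n)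
    (𝓕 : Finset (Submodule 𝔽 (Fin n → 𝔽)))
    (hdim : ∀ U ∈ 𝓕, Module.finrank 𝔽 U = k)
    (hint : ∀ U ∈ 𝓕, ∀ U' ∈ 𝓕, t ≤ Module.finrank 𝔽 ↥(U ⊓ U')) :
    𝓕.card ≤ gaussBinom q (n - t) (k - t) ∧
      (𝓕.card = gaussBinom q (n - t) (k - t) ↔
        ((∃ T : Submodule 𝔽 (Fin n → 𝔽), Module.finrank 𝔽 T = t ∧
            ∀ U : Submodule 𝔽 (Fin n → 𝔽),
              U ∈ 𝓕 ↔ (Module.finrank 𝔽 U = k ∧ T ≤ U)) ∨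
         (n = 2 * k ∧ ∃ S : Submodule 𝔽 (Fin n → 𝔽), Module.finrank 𝔽 S = 2 * k - t ∧
            ∀ U : Submodule 𝔽 (Fin n → 𝔽),
              U ∈ 𝓕 ↔ (Module.finrank 𝔽 U = k ∧ U ≤ S)))) := by
  obtain ⟨F, hFdef⟩ : ∃ F : Finset (X 𝔽 (Fin n → 𝔽) k), F = Finset.univ.filter fun z => z.1 ∈ 𝓕 := ⟨_, rfl⟩
  have hmem : ∀ z : X 𝔽 (Fin n → 𝔽) k, z ∈ F ↔ z.1 ∈ 𝓕 := fun z => by simp [hFdef]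
  have hcard : F.card = 𝓕.card := by
    rw [← Finset.card_map (Function.Embedding.subtype _) (s := F)]
    congr 1
    ext U
    rw [Finset.mem_map]
    constructor
    · rintro ⟨z, hz, rfl⟩
      exact (hmem z).1 hz
    · intro hU
      exact ⟨⟨U, hdim U hU⟩, (hmem _).2 hU, rfl⟩
  have hV : Module.finrank 𝔽 (Fin n → 𝔽) = n := by simp
  have hqq : qq 𝔽 = (q : ℝ) := by rw [← hq]
  have hq2 : 2 ≤ q := by rw [← hq]; exact Fintype.one_lt_card
  have hti : TInt t F := fun U hU z hz => hint _ ((hmem z).1 hz) _ ((hmem U).1 hU)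
  have hmain := main_X htk (by rw [hV]; exact hn) hti
  obtain ⟨T0, hT0⟩ := exists_X (𝔽 := 𝔽) (V := Fin n → 𝔽) t (by rw [hV]; omega)
  have hC := card_starF k t T0 hT0 htk
  have hg := gaussBinom_eq q n t k _ hq2 htk (by omega) (by rw [hC, hV, hqq])
  rw [← hg] at hC
  rw [← hC, hcard] at hmain
  refine ⟨by exact_mod_cast hmain.1, fun hc => ?_, fun hc => ?_⟩
  · rcases hmain.2 (by exact_mod_cast hc) with ⟨T, hT, h1⟩ | ⟨hn2, S, hS, h1⟩
    · refine Or.inl ⟨T, hT, fun U => ⟨fun hU => ⟨hdim U hU, ?_⟩, fun hU => ?_⟩⟩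
      · exact (h1 ⟨U, hdim U hU⟩).1 ((hmem _).2 hU)
      · exact (hmem _).1 ((h1 ⟨U, hU.1⟩).2 hU.2)
    · refine Or.inr ⟨by rw [← hn2, hV], S, hS, fun U => ⟨fun hU => ⟨hdim U hU, ?_⟩, fun hU => ?_⟩⟩
      · exact (h1 ⟨U, hdim U hU⟩).1 ((hmem _).2 hU)
      · exact (hmem _).1 ((h1 ⟨U, hU.1⟩).2 hU.2)
  · rw [← hcard]
    have : (F.card : ℝ) = (gaussBinom q (n - t) (k - t) : ℕ) := by
      rcases hc with ⟨T, hT, h1⟩ | ⟨hn2, S, hS, h1⟩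
      · rw [hC, ← card_starF k t T hT htk]
        congr 2
        ext z
        rw [hmem, h1, mem_starF]
        exact ⟨fun h => h.2, fun h => ⟨z.2, h⟩⟩
      · rw [hC, show Module.finrank 𝔽 (Fin n → 𝔽) = 2 * k from hV.trans hn2, ← cc_dual qq_ge htk, ← hS, ← cnt_zero k S, ← chi_sum]
        refine Finset.sum_congr rfl fun z _ => ind_congr ?_
        rw [hmem, h1]
        exact ⟨fun h => h.2, fun h => ⟨z.2, h⟩⟩
    exact_mod_cast this

end final

end EKRq

end partG

/-- **`q`-analogue of the Erdős–Ko–Rado theorem (Hsieh; Frankl–Wilson; Tanaka), case `n ≥ 2k`.**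
Let `V = F_q^n`, `0 ≤ t ≤ k`, and let `𝓕` be a family of `k`-dimensional subspaces of `V`
pairwise intersecting in dimension at least `t`. If `n ≥ 2k` then
`|𝓕| ≤ [n-t choose k-t]_q`, with equality iff `𝓕` is the set of all `k`-dimensional
subspaces containing a fixed `t`-dimensional subspace, or `n = 2k` and `𝓕` is the set of
all `k`-dimensional subspaces contained in a fixed `(2k-t)`-dimensional subspace. -/
theorem ekr_q_analogue {𝔽 : Type*} [Field 𝔽] [Fintype 𝔽] (q n k t : ℕ)
    (hq : Fintype.card 𝔽 = q) (htk : t ≤ k) (hn : 2 * k ≤ n)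
    (𝓕 : Finset (Submodule 𝔽 (Fin n → 𝔽)))
    (hdim : ∀ U ∈ 𝓕, Module.finrank 𝔽 U = k)
    (hint : ∀ U ∈ 𝓕, ∀ U' ∈ 𝓕, t ≤ Module.finrank 𝔽 ↥(U ⊓ U')) :
    𝓕.card ≤ gaussBinom q (n - t) (k - t) ∧
      (𝓕.card = gaussBinom q (n - t) (k - t) ↔
        ((∃ T : Submodule 𝔽 (Fin n → 𝔽), Module.finrank 𝔽 T = t ∧
            ∀ U : Submodule 𝔽 (Fin n → 𝔽),
              U ∈ 𝓕 ↔ (Module.finrank 𝔽 U = k ∧ T ≤ U)) ∨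
         (n = 2 * k ∧ ∃ S : Submodule 𝔽 (Fin n → 𝔽), Module.finrank 𝔽 S = 2 * k - t ∧
            ∀ U : Submodule 𝔽 (Fin n → 𝔽),
              U ∈ 𝓕 ↔ (Module.finrank 𝔽 U = k ∧ U ≤ S)))) := by
  exact EKRq.main_aux q n k t hq htk hn 𝓕 hdim hint
end

section
/- Let q be a prime power, let V = F_q^n, and let d, e be integers with d + e = n and e ≥ d. Fix an e-dimensional subspace W of V and let 𝓤 be the set of all d-dimensional subspaces γ of V with γ ∩ W = {0}. Let 0 ≤ t ≤ d be an integer and let 𝓕 ⊆ 𝓤 satisfy dim(γ ∩ δ) ≥ t for all γ, δ ∈ 𝓕. Then |𝓕| ≤ q^{(d−t)e}. Moreover, if U₀ is a fixed t-dimensional subspace with U₀ ∩ W = {0}, then the family of all γ ∈ 𝓤 containing U₀ attains this bound. -/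
open Polynomial in
lemma gab_ker {F K : Type*} [Field F] [Fintype F] [Field K] [Algebra F K] [Finite K]
    {A : Type*} [AddCommGroup A] [Module F A] [Module.Finite F A]
    (j : A →ₗ[F] K) (hj : Function.Injective j) (t : ℕ) (a : Fin t → K) (ha : a ≠ 0)
    (N : Submodule F A)
    (hN : ∀ x ∈ N, ∑ i, a i * (j x) ^ (Fintype.card F ^ (i : ℕ)) = 0) :
    Module.finrank F N < t := by
  classical
  have := Fintype.ofFinite K
  set q := Fintype.card F with hq
  have hq1 : 1 < q := Fintype.one_lt_card
  set P : K[X] := ∑ i : Fin t, C (a i) * X ^ (q ^ (i : ℕ)) with hP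
  have ht : 0 < t := by
    rcases Nat.eq_zero_or_pos t with h | h
    · subst h
      exact absurd (Subsingleton.elim _ _) ha
    · exact h
  have hdeg : P.natDegree ≤ q ^ (t - 1) := by
    refine natDegree_sum_le_of_forall_le _ _ fun i _ => ?_
    refine (natDegree_C_mul_X_pow_le _ _).trans ?_
    exact Nat.pow_le_pow_right hq1.le (by omega)
  have hP0 : P ≠ 0 := by
    intro h
    apply ha
    funext i
    have h1 : P.coeff (q ^ (i : ℕ)) = a i := by
      rw [hP, finsetSum_coeff, Finset.sum_eq_single i]
      · simp
      · intro b _ hb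
        rw [coeff_C_mul_X_pow, if_neg]
        intro h2
        exact hb (Fin.ext (Nat.pow_right_injective hq1 h2).symm)
      · simp
    rw [← h1, h]; simp
  have hcard : Nat.card N ≤ q ^ (t - 1) := by
    let f : N → P.roots.toFinset := fun x => ⟨j x, by
      rw [Multiset.mem_toFinset, mem_roots hP0, IsRoot.def, hP, eval_finsetSum]
      simpa using hN x x.2⟩
    have hf : Function.Injective f := fun x y hxy =>
      Subtype.ext (hj (congrArg Subtype.val hxy))
    have h1 := Nat.card_le_card_of_injective f hf
    rw [Nat.card_eq_fintype_card (α := P.roots.toFinset), Fintype.card_coe] at h1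
    exact h1.trans ((Multiset.toFinset_card_le _).trans ((card_roots' _).trans hdeg))
  rw [Module.natCard_eq_pow_finrank (K := F), Nat.card_eq_fintype_card, ← hq] at hcard
  have := (Nat.pow_le_pow_iff_right hq1).1 hcard
  omega

lemma exists_code {F : Type*} [Field F] [Fintype F] {A B : Type*} [AddCommGroup A] [Module F A]
    [Module.Finite F A] [AddCommGroup B] [Module F B] [Module.Finite F B] (t : ℕ)
    (hAB : Module.finrank F A ≤ Module.finrank F B) (htA : t ≤ Module.finrank F A) :
    ∃ (I : Type) (S : I → (A →ₗ[F] B)),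
      Nat.card I = Fintype.card F ^ (t * Module.finrank F B) ∧
      ∀ i k, i ≠ k → Module.finrank F (LinearMap.ker (S i - S k)) < t := by
  rcases Nat.eq_zero_or_pos t with rfl | ht
  · exact ⟨Unit, fun _ => 0, by simp, fun i k h => absurd (Subsingleton.elim _ _) h⟩
  obtain ⟨p, hp⟩ := CharP.exists F
  have : Fact p.Prime := ⟨CharP.char_is_prime F p⟩
  set e := Module.finrank F B with he
  have : NeZero e := ⟨by omega⟩
  let K := FiniteField.Extension F p e
  have hK : Module.finrank F K = e := FiniteField.finrank_extension F p e
  let φ : K ≃ₗ[F] B := LinearEquiv.ofFinrankEq K B hK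
  obtain ⟨j, hj⟩ := (finrank_le_iff_exists_linearMap (R := F) (M := A) (M' := K)).1
    (by rw [hK]; exact hAB)
  let T : (Fin t → K) → (A →ₗ[F] K) := fun a =>
    ∑ i, (LinearMap.mulLeft F (a i)) ∘ₗ
      (((FiniteField.frobeniusAlgHom F K) ^ (i : ℕ)).toLinearMap) ∘ₗ j
  have hT : ∀ a x, T a x = ∑ i, a i * (j x) ^ (Fintype.card F ^ (i : ℕ)) := by
    intro a x
    have hpow : ∀ (i : ℕ) (y : K), ((FiniteField.frobeniusAlgHom F K) ^ i) y
        = y ^ (Fintype.card F ^ i) := by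
      intro i y
      rw [AlgHom.coe_pow, FiniteField.coe_frobeniusAlgHom, pow_iterate]
    simp only [T, LinearMap.sum_apply, LinearMap.comp_apply, LinearMap.mulLeft_apply,
      AlgHom.toLinearMap_apply, hpow]
  refine ⟨Fin t → K, fun a => φ.toLinearMap ∘ₗ T a, ?_, ?_⟩
  · rw [Nat.card_fun, Module.natCard_eq_pow_finrank (K := F) (V := K), hK]
    simp [← pow_mul, mul_comm]
  · intro a b hab
    refine gab_ker j hj t (a - b) (sub_ne_zero.2 hab) _ ?_
    intro x hx
    rw [LinearMap.mem_ker, LinearMap.sub_apply, sub_eq_zero] at hx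
    have hx' : T a x = T b x := φ.injective hx
    rw [hT, hT] at hx'
    simp only [Pi.sub_apply, sub_mul, Finset.sum_sub_distrib, hx', sub_self]

lemma count_proj {F V : Type*} [Field F] [Fintype F] [AddCommGroup V] [Module F V]
    [Module.Finite F V] (W U : Submodule F V) (h : Disjoint U W) :
    Nat.card {f : V →ₗ[F] W // (∀ x : W, f x = x) ∧ U ≤ LinearMap.ker f} =
      Fintype.card F ^ ((Module.finrank F V - (Module.finrank F U + Module.finrank F W))
        * Module.finrank F W) := by
  obtain ⟨C, hUC, hC⟩ := h.exists_isCompl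
  set f0 : V →ₗ[F] W := W.projectionOnto C hC.symm with hf0
  have h0W : ∀ x : W, f0 x = x := Submodule.projectionOnto_apply_left hC.symm
  have h0U : ∀ x ∈ U, f0 x = 0 := fun x hx => by
    rw [← LinearMap.mem_ker, hf0, Submodule.ker_projectionOnto]; exact hUC hx
  let E : {f : V →ₗ[F] W // (∀ x : W, f x = x) ∧ U ≤ LinearMap.ker f} ≃
      ((V ⧸ (U ⊔ W)) →ₗ[F] W) :=
    { toFun := fun f => (U ⊔ W).liftQ (f.1 - f0) (by
        refine sup_le (fun x hx => ?_) (fun x hx => ?_)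
        · have := f.2.2 hx
          rw [LinearMap.mem_ker] at this ⊢
          rw [LinearMap.sub_apply, this, h0U x hx, sub_zero]
        · have h1 := f.2.1 ⟨x, hx⟩
          have h2 := h0W ⟨x, hx⟩
          rw [LinearMap.mem_ker, LinearMap.sub_apply]
          rw [h1, h2, sub_self])
      invFun := fun g => ⟨f0 + g ∘ₗ (U ⊔ W).mkQ, by
        intro x
        have : (U ⊔ W).mkQ (x : V) = 0 := by
          simpa using (le_sup_right : W ≤ U ⊔ W) x.2
        rw [LinearMap.add_apply, LinearMap.comp_apply, this, map_zero, add_zero, h0W], by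
        intro x hx
        have : (U ⊔ W).mkQ x = 0 := by
          simpa using (le_sup_left : U ≤ U ⊔ W) hx
        rw [LinearMap.mem_ker, LinearMap.add_apply, LinearMap.comp_apply, this, map_zero,
          add_zero, h0U x hx]⟩
      left_inv := fun f => by
        apply Subtype.ext
        simp
      right_inv := fun g => by
        apply Submodule.linearMap_qext
        simp }
  rw [Nat.card_congr E, Module.natCard_eq_pow_finrank (K := F), Module.finrank_linearMap,
    Nat.card_eq_fintype_card]
  have h1 := Submodule.finrank_quotient_add_finrank (U ⊔ W)
  have h2 := Submodule.finrank_sup_add_finrank_inf_eq U W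
  rw [h.eq_bot, finrank_bot] at h2
  congr 2
  omega

lemma isCompl_of_dim {F V : Type*} [Field F] [AddCommGroup V] [Module F V]
    [Module.Finite F V] (W γ : Submodule F V)
    (hd : Module.finrank F γ + Module.finrank F W = Module.finrank F V) (h : γ ⊓ W = ⊥) :
    IsCompl W γ := by
  refine ⟨(disjoint_iff.2 h).symm, codisjoint_iff.2 ?_⟩
  apply Submodule.eq_top_of_finrank_eq
  have h2 := Submodule.finrank_sup_add_finrank_inf_eq γ W
  rw [h, finrank_bot] at h2
  rw [sup_comm]; omega

/-- **Tanaka's theorem.** Let `V = F_q^n`, `d + e = n` with `e ≥ d`, let `W` be a fixed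
`e`-dimensional subspace of `V` and `𝓤` the set of `d`-dimensional subspaces `γ` with
`γ ∩ W = {0}`. If `0 ≤ t ≤ d` and `𝓕 ⊆ 𝓤` satisfies `dim(γ ∩ δ) ≥ t` for all
`γ, δ ∈ 𝓕`, then `|𝓕| ≤ q^{(d-t)e}`. Moreover, for any fixed `t`-dimensional subspace
`U₀` with `U₀ ∩ W = {0}`, the family of all `γ ∈ 𝓤` containing `U₀` attains this bound. -/
theorem tanaka {𝔽 : Type*} [Field 𝔽] [Fintype 𝔽] (q n d e t : ℕ)
    (hq : Fintype.card 𝔽 = q) (hde : d + e = n) (hed : d ≤ e) (htd : t ≤ d)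
    (W : Submodule 𝔽 (Fin n → 𝔽)) (hW : Module.finrank 𝔽 W = e)
    (𝓕 : Finset (Submodule 𝔽 (Fin n → 𝔽)))
    (hmem : ∀ γ ∈ 𝓕, Module.finrank 𝔽 γ = d ∧ γ ⊓ W = ⊥)
    (hint : ∀ γ ∈ 𝓕, ∀ δ ∈ 𝓕, t ≤ Module.finrank 𝔽 ↥(γ ⊓ δ)) :
    𝓕.card ≤ q ^ ((d - t) * e) ∧
      ∀ U₀ : Submodule 𝔽 (Fin n → 𝔽), Module.finrank 𝔽 U₀ = t → U₀ ⊓ W = ⊥ →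
        Nat.card {γ : Submodule 𝔽 (Fin n → 𝔽) //
            Module.finrank 𝔽 γ = d ∧ γ ⊓ W = ⊥ ∧ U₀ ≤ γ} = q ^ ((d - t) * e) := by
  have hV : Module.finrank 𝔽 (Fin n → 𝔽) = n := by simp
  constructor
  · have hA : Module.finrank 𝔽 ((Fin n → 𝔽) ⧸ W) = d := by
      have := Submodule.finrank_quotient_add_finrank W
      omega
    obtain ⟨I, S, hI, hS⟩ := exists_code (F := 𝔽) (A := (Fin n → 𝔽) ⧸ W) (B := W) t
      (by omega) (by omega)
    have hc : ∀ γ : 𝓕, IsCompl W γ.1 := fun γ =>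
      isCompl_of_dim W γ.1 (by rw [(hmem γ.1 γ.2).1]; omega) (hmem γ.1 γ.2).2
    have hcount := count_proj W (⊥ : Submodule 𝔽 (Fin n → 𝔽)) disjoint_bot_left
    rw [finrank_bot, hV, hW, zero_add, hq] at hcount
    let Φ : 𝓕 × I → {f : (Fin n → 𝔽) →ₗ[𝔽] W // (∀ x : W, f x = x) ∧ ⊥ ≤ LinearMap.ker f} :=
      fun x => ⟨W.projectionOnto x.1.1 (hc x.1) + S x.2 ∘ₗ W.mkQ, by
        intro y
        have : W.mkQ (y : Fin n → 𝔽) = 0 := by simp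
        rw [LinearMap.add_apply, LinearMap.comp_apply, this, map_zero, add_zero,
          Submodule.projectionOnto_apply_left], bot_le⟩
    have hΦ : Function.Injective Φ := by
      rintro ⟨γ, i⟩ ⟨δ, k⟩ hxy
      have hxy' : W.projectionOnto γ.1 (hc γ) + S i ∘ₗ W.mkQ =
        W.projectionOnto δ.1 (hc δ) + S k ∘ₗ W.mkQ := congrArg Subtype.val hxy
      have hik : i = k := by
        by_contra hne
        have h1 := hS i k hne
        have h2 := hint γ.1 γ.2 δ.1 δ.2
        let g : ↥(γ.1 ⊓ δ.1) →ₗ[𝔽] LinearMap.ker (S i - S k) :=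
          (W.mkQ ∘ₗ (γ.1 ⊓ δ.1).subtype).codRestrict _ (by
            intro x
            have h3 := LinearMap.congr_fun hxy' x.1
            have h4 : W.projectionOnto γ.1 (hc γ) x.1 = 0 := by
              rw [← LinearMap.mem_ker, Submodule.ker_projectionOnto]; exact x.2.1
            have h5 : W.projectionOnto δ.1 (hc δ) x.1 = 0 := by
              rw [← LinearMap.mem_ker, Submodule.ker_projectionOnto]; exact x.2.2
            rw [LinearMap.add_apply, LinearMap.add_apply, h4, h5, zero_add, zero_add] at h3
            rw [LinearMap.mem_ker, LinearMap.sub_apply, sub_eq_zero]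
            exact h3)
        have hg : Function.Injective g := by
          rw [← LinearMap.ker_eq_bot, LinearMap.ker_codRestrict, LinearMap.ker_eq_bot']
          intro x hx
          have hx' : x.1 ∈ W := by simpa using hx
          have : x.1 ∈ γ.1 ⊓ W := ⟨x.2.1, hx'⟩
          rw [(hmem γ.1 γ.2).2] at this
          exact Subtype.ext ((Submodule.mem_bot 𝔽).1 this)
        have := LinearMap.finrank_le_finrank_of_injective hg
        omega
      subst hik
      have h6 : W.projectionOnto γ.1 (hc γ) = W.projectionOnto δ.1 (hc δ) :=
        LinearMap.ext fun x => add_right_cancel (LinearMap.congr_fun hxy' x)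
      have h7 := congrArg LinearMap.ker h6
      rw [Submodule.ker_projectionOnto, Submodule.ker_projectionOnto] at h7
      rw [Subtype.ext h7]
    have hq0 : 0 < q := hq ▸ Fintype.card_pos
    have hfin : Finite {f : (Fin n → 𝔽) →ₗ[𝔽] W // (∀ x : W, f x = x) ∧ ⊥ ≤ LinearMap.ker f} :=
      Nat.finite_of_card_ne_zero (by rw [hcount]; positivity)
    have hle := Nat.card_le_card_of_injective Φ hΦ
    rw [hcount, Nat.card_prod, hI, hW, hq, Nat.card_eq_fintype_card, Fintype.card_coe] at hle
    have hsplit : q ^ ((n - e) * e) = q ^ ((d - t) * e) * q ^ (t * e) := by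
      rw [← pow_add, ← add_mul]; congr 2; omega
    rw [hsplit] at hle
    exact Nat.le_of_mul_le_mul_right hle (by positivity)
  · intro U₀ hU hUW
    have hcount := count_proj W U₀ (disjoint_iff.2 hUW)
    rw [hU, hV, hW, hq] at hcount
    have : n - (t + e) = d - t := by omega
    rw [this] at hcount
    rw [← hcount]
    have hc : ∀ γ : Submodule 𝔽 (Fin n → 𝔽), Module.finrank 𝔽 γ = d → γ ⊓ W = ⊥ → IsCompl W γ :=
      fun γ h1 h2 => isCompl_of_dim W γ (by omega) h2
    refine Nat.card_congr
      { toFun := fun γ => ⟨W.projectionOnto γ.1 (hc γ.1 γ.2.1 γ.2.2.1),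
          Submodule.projectionOnto_apply_left _, by
            rw [Submodule.ker_projectionOnto]; exact γ.2.2.2⟩
        invFun := fun f => ⟨LinearMap.ker f.1, by
          have h1 := LinearMap.isCompl_of_proj f.2.1
          refine ⟨?_, h1.symm.inf_eq_bot, f.2.2⟩
          have := Submodule.finrank_add_eq_of_isCompl h1
          omega⟩
        left_inv := fun γ => Subtype.ext (Submodule.ker_projectionOnto _)
        right_inv := fun f => Subtype.ext (LinearMap.projectionOnto_of_proj f.1 f.2.1) }
end
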